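/- arXiv:gr-qc/0201046 — 3 statements merged into one kernel-verified Lean document; each statement's English description precedes it below -/
import Mathlib

section
/- For every α ∈ (0, 1/2) and every c > 0 there exists ρ₁(c) ∈ (√(1−2α), 1) such that the c-orbit is defined for all 0 < ρ < ρ₁(c) and lim_{ρ→ρ₁(c)⁻} Z(ρ) = 1. Furthermore the limits H̄ := lim_{ρ→ρ₁(c)⁻} H(ρ) and Ā := lim_{ρ→ρ₁(c)⁻} A(ρ) exist and satisfy −π/2 < H̄ < π/2 and Ā = 1 − 2α cos²H̄, and lim_{ρ→ρ₁(c)⁻} (1 − Z(ρ)²) H′(ρ)² = 0. -/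
open Real Filter Set Topology Asymptotics MeasureTheory

noncomputable section

/-- The CSS (continuously self-similar) system for `(H, A, Z)` with derivative
function `H'`, on the interval `(0, ρ₁)`, together with the constraint, the
positivity/range conditions, and the initial conditions at `ρ = 0`:
`H(0) = -π/2`, `H'(0) = c`, `A(0) = 1`, `Z(0) = 0`, `Z'(0) = 1`.  This is the
notion of a `c`-orbit. -/
structure IsCOrbit (α c : ℝ) (H H' A Z : ℝ → ℝ) (ρ₁ : ℝ) : Prop where
  rho1_pos : 0 < ρ₁
  hH : ∀ ρ ∈ Set.Ioo 0 ρ₁, HasDerivAt H (H' ρ) ρ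
  hH' : ∀ ρ ∈ Set.Ioo 0 ρ₁, HasDerivAt H'
      (α * (1 + Z ρ ^ 2) * ρ * H' ρ ^ 3 - (2 / ρ) * H' ρ
        - Real.sin (2 * H ρ) / (A ρ * ρ ^ 2 * (1 - Z ρ ^ 2))) ρ
  hA : ∀ ρ ∈ Set.Ioo 0 ρ₁, HasDerivAt A (-2 * α * ρ * A ρ * H' ρ ^ 2) ρ
  hZ : ∀ ρ ∈ Set.Ioo 0 ρ₁, HasDerivAt Z
      (Z ρ * (1 + α * (1 - Z ρ ^ 2) * ρ ^ 2 * H' ρ ^ 2) / ρ) ρ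
  constraint : ∀ ρ ∈ Set.Ioo 0 ρ₁,
      1 - 2 * α - A ρ + 2 * α * Real.sin (H ρ) ^ 2
        + α * A ρ * ρ ^ 2 * H' ρ ^ 2 * (1 - Z ρ ^ 2) = 0
  hApos : ∀ ρ ∈ Set.Ioo 0 ρ₁, 0 < A ρ
  hZ01 : ∀ ρ ∈ Set.Ioo 0 ρ₁, 0 ≤ Z ρ ∧ Z ρ < 1
  H0 : H 0 = -(π / 2)
  A0 : A 0 = 1
  Z0 : Z 0 = 0
  Hcont : Tendsto H (𝓝[>] 0) (𝓝 (-(π / 2)))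
  H'init : Tendsto H' (𝓝[>] 0) (𝓝 c)
  Acont : Tendsto A (𝓝[>] 0) (𝓝 1)
  Zcont : Tendsto Z (𝓝[>] 0) (𝓝 0)
  Z'init : Tendsto (fun ρ => Z ρ / ρ) (𝓝[>] 0) (𝓝 1)

theorem abs_integral_exp_mul_abs_le {l : ℝ} (hl : 0 < l) (t : ℝ) :
    |∫ s in (0:ℝ)..t, exp (l * |s|)| ≤ exp (l * |t|) / l := by
  have key : ∀ t : ℝ, 0 ≤ t → |∫ s in (0:ℝ)..t, exp (l * |s|)| ≤ exp (l * t) / l := by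
    intro t ht
    have h1 : ∫ s in (0:ℝ)..t, exp (l * |s|) = ∫ s in (0:ℝ)..t, exp (l * s) := by
      apply intervalIntegral.integral_congr
      intro s hs
      rw [uIcc_of_le ht] at hs
      simp [abs_of_nonneg hs.1]
    rw [h1, intervalIntegral.integral_comp_mul_left (fun x => exp x) hl.ne', integral_exp]
    have : (1:ℝ) ≤ exp (l * t) := one_le_exp (by positivity)
    simp only [mul_zero, exp_zero, smul_eq_mul]
    rw [abs_of_nonneg (mul_nonneg (by positivity) (by linarith)), div_eq_inv_mul]
    gcongr
    linarith
  rcases le_total 0 t with ht | ht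
  · simpa [abs_of_nonneg ht] using key t ht
  · have h := key (-t) (by linarith)
    have h2 : ∫ s in (0:ℝ)..t, exp (l * |s|) = - ∫ s in (0:ℝ)..(-t), exp (l * |s|) := by
      have := intervalIntegral.integral_comp_neg (a := 0) (b := t) (fun s => exp (l * |s|))
      simp only [abs_neg, neg_zero] at this
      rw [this, intervalIntegral.integral_symm]
    rw [h2, abs_neg, abs_of_nonpos ht]
    exact h

theorem LipschitzWith.exists_forall_hasDerivAt {E : Type*} [NormedAddCommGroup E]
    [NormedSpace ℝ E] [CompleteSpace E] {G : E → E} {K : NNReal} (hG : LipschitzWith K G)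
    (y₀ : E) (t₀ : ℝ) : ∃ y : ℝ → E, y t₀ = y₀ ∧ ∀ t, HasDerivAt y (G (y t)) t := by
  set l : ℝ := K + 1 with hl
  have hl0 : 0 < l := by positivity
  have hKl : (K : ℝ) / l < 1 := by rw [div_lt_one hl0]; linarith
  have hw : Continuous fun s : ℝ => exp (l * |s|) := by fun_prop
  have hcont : ∀ u : BoundedContinuousFunction ℝ E,
      Continuous fun s => G (y₀ + exp (l * |s|) • u s) := fun u =>
    hG.continuous.comp (continuous_const.add (hw.smul u.continuous))
  have hderiv : ∀ u : BoundedContinuousFunction ℝ E, ∀ t, HasDerivAt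
      (fun t => ∫ s in (0:ℝ)..t, G (y₀ + exp (l * |s|) • u s))
      (G (y₀ + exp (l * |t|) • u t)) t := fun u t =>
    intervalIntegral.integral_hasDerivAt_right ((hcont u).intervalIntegrable _ _)
      ((hcont u).stronglyMeasurableAtFilter _ _) (hcont u).continuousAt
  have hbound : ∀ (f : ℝ → E) (M : ℝ), 0 ≤ M → (∀ s, ‖f s‖ ≤ M * exp (l * |s|)) → ∀ t,
      ‖exp (-(l * |t|)) • ∫ s in (0:ℝ)..t, f s‖ ≤ M / l := by
    intro f M hM hf t
    have h1 : ‖∫ s in (0:ℝ)..t, f s‖ ≤ |∫ s in (0:ℝ)..t, M * exp (l * |s|)| :=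
      intervalIntegral.norm_integral_le_abs_of_norm_le (ae_of_all _ fun s => hf s)
        ((hw.const_mul M).intervalIntegrable _ _)
    rw [intervalIntegral.integral_const_mul, abs_mul, abs_of_nonneg hM] at h1
    have h2 := h1.trans (mul_le_mul_of_nonneg_left (abs_integral_exp_mul_abs_le hl0 t) hM)
    rw [norm_smul, Real.norm_eq_abs, abs_of_pos (exp_pos _)]
    calc _ ≤ exp (-(l * |t|)) * (M * (exp (l * |t|) / l)) := by gcongr
      _ = M / l := by rw [exp_neg]; field_simp
  let T : BoundedContinuousFunction ℝ E → BoundedContinuousFunction ℝ E := fun u =>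
    BoundedContinuousFunction.ofNormedAddCommGroup
      (fun t => exp (-(l * |t|)) • ∫ s in (0:ℝ)..t, G (y₀ + exp (l * |s|) • u s))
      ((by fun_prop : Continuous fun t : ℝ => exp (-(l * |t|))).smul
        (continuous_iff_continuousAt.2 fun t => (hderiv u t).continuousAt))
      ((‖G y₀‖ + K * ‖u‖) / l)
      (hbound _ _ (by positivity) (by
        intro s
        have h1 : ‖G (y₀ + exp (l * |s|) • u s)‖ ≤ ‖G y₀‖ + K * (exp (l * |s|) * ‖u s‖) := by
          have := hG.norm_sub_le (y₀ + exp (l * |s|) • u s) y₀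
          rw [add_sub_cancel_left, norm_smul, Real.norm_eq_abs, abs_of_pos (exp_pos _)] at this
          linarith [norm_le_norm_add_norm_sub' (G (y₀ + exp (l * |s|) • u s)) (G y₀)]
        have h2 : (1:ℝ) ≤ exp (l * |s|) := one_le_exp (by positivity)
        calc _ ≤ _ := h1
          _ ≤ ‖G y₀‖ * exp (l * |s|) + K * (exp (l * |s|) * ‖u‖) := by
            gcongr
            · exact le_mul_of_one_le_right (norm_nonneg _) h2
            · exact u.norm_coe_le_norm s
          _ = _ := by ring))
  have hT : ContractingWith (K / ⟨l, hl0.le⟩) T := by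
    refine ⟨by rw [← NNReal.coe_lt_coe]; exact hKl, LipschitzWith.of_dist_le_mul fun u v => ?_⟩
    rw [BoundedContinuousFunction.dist_le (by positivity)]
    intro t
    have : T u t - T v t = exp (-(l * |t|)) • ∫ s in (0:ℝ)..t,
        (G (y₀ + exp (l * |s|) • u s) - G (y₀ + exp (l * |s|) • v s)) := by
      rw [intervalIntegral.integral_sub ((hcont u).intervalIntegrable _ _)
        ((hcont v).intervalIntegrable _ _), smul_sub]
      rfl
    rw [dist_eq_norm, this]
    refine (hbound _ (K * dist u v) (by positivity) (fun s => ?_) t).trans (le_of_eq ?_)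
    · refine (hG.norm_sub_le _ _).trans ?_
      rw [add_sub_add_left_eq_sub, ← smul_sub, norm_smul, Real.norm_eq_abs,
        abs_of_pos (exp_pos _), mul_assoc, mul_comm (dist u v), ← dist_eq_norm]
      gcongr
      exact BoundedContinuousFunction.dist_coe_le_dist s
    · change K * dist u v / l = K / l * dist u v
      ring
  obtain ⟨u, hu⟩ : ∃ u, T u = u := ⟨_, hT.fixedPoint_isFixedPt⟩
  have hu' : ∀ t, exp (l * |t|) • u t = ∫ s in (0:ℝ)..t, G (y₀ + exp (l * |s|) • u s) := by
    intro t
    have : u t = exp (-(l * |t|)) • ∫ s in (0:ℝ)..t, G (y₀ + exp (l * |s|) • u s) := by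
      conv_lhs => rw [← hu]
      rfl
    rw [this, smul_smul, ← exp_add, add_neg_cancel, exp_zero, one_smul]
  have hy : ∀ t, HasDerivAt (fun t => y₀ + exp (l * |t|) • u t)
      (G (y₀ + exp (l * |t|) • u t)) t := by
    intro t
    have h := (hderiv u t).const_add y₀
    exact h.congr_of_eventuallyEq (Eventually.of_forall fun s => congrArg (y₀ + ·) (hu' s))
  refine ⟨fun t => y₀ + exp (l * |t - t₀|) • u (t - t₀), ?_, fun t => ?_⟩
  · have h0 : u 0 = 0 := by simpa using hu' 0
    simp [h0]
  · exact (hy (t - t₀)).comp_sub_const t t₀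

theorem hasDerivAt_smul_integral_pow_smul {V : Type*} [NormedAddCommGroup V] [NormedSpace ℝ V]
    [CompleteSpace V] {g : ℝ → V} (hg : Continuous g) (k : ℕ) {x : ℝ} (hx : 0 < x) :
    HasDerivAt (fun x => x • ∫ s in (0:ℝ)..1, s ^ k • g (x * s))
      (g x - (k / x) • (x • ∫ s in (0:ℝ)..1, s ^ k • g (x * s))) x := by
  have hrepr : ∀ z : ℝ, 0 < z → z • ∫ s in (0:ℝ)..1, s ^ k • g (z * s)
      = (z ^ k)⁻¹ • ∫ r in (0:ℝ)..z, r ^ k • g r := by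
    intro z hz
    have h := intervalIntegral.smul_integral_comp_mul_left (a := 0) (b := 1)
      (fun r => r ^ k • g r) z
    simp only [mul_zero, mul_one, mul_pow, mul_smul] at h
    rw [← h, intervalIntegral.integral_smul, smul_comm z, smul_smul (z ^ k)⁻¹,
      inv_mul_cancel₀ (by positivity), one_smul]
  have hc : Continuous fun r : ℝ => r ^ k • g r := by fun_prop
  have h1 : HasDerivAt (fun z => ∫ r in (0:ℝ)..z, r ^ k • g r) (x ^ k • g x) x :=
    intervalIntegral.integral_hasDerivAt_right (hc.intervalIntegrable _ _)
      (hc.stronglyMeasurableAtFilter _ _) hc.continuousAt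
  have h2 : HasDerivAt (fun z : ℝ => (z ^ k)⁻¹) (-(k / x) * (x ^ k)⁻¹) x := by
    have := (hasDerivAt_pow k x).inv (by positivity)
    have heq : -(k / x) * (x ^ k)⁻¹ = -(k * x ^ (k - 1)) / (x ^ k) ^ 2 := by
      rcases k with _ | k
      · simp
      · field_simp
        simp [pow_succ']
    rw [heq]
    exact this
  have h3 := h2.smul h1
  have h4 : HasDerivAt (fun x => x • ∫ s in (0:ℝ)..1, s ^ k • g (x * s))
      ((x ^ k)⁻¹ • x ^ k • g x + (-(k / x) * (x ^ k)⁻¹) • ∫ r in (0:ℝ)..x, r ^ k • g r) x :=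
    h3.congr_of_eventuallyEq (by
      filter_upwards [lt_mem_nhds hx] with z hz
      exact hrepr z hz)
  convert h4 using 1
  rw [hrepr x hx, smul_smul _ (x ^ k), inv_mul_cancel₀ (by positivity), one_smul, mul_smul,
    neg_smul, sub_eq_add_neg]

theorem exists_tangent_solution {E F : Type*} [NormedAddCommGroup E] [NormedSpace ℝ E]
    [CompleteSpace E] [NormedAddCommGroup F] [NormedSpace ℝ F] [CompleteSpace F]
    {N : E × F → E × F} (hNc : Continuous N) (hN0 : N 0 = 0) {C r : ℝ} (hC : 0 ≤ C) (hr : 0 < r)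
    (hN : ∀ v w R, R < r → ‖v‖ ≤ R → ‖w‖ ≤ R → ‖N v - N w‖ ≤ C * R * ‖v - w‖) (u₀ : E) :
    ∃ (a : ℝ) (y : ℝ → E × F),
      (∀ t < a, HasDerivAt y ((y t).1 + (N (y t)).1, (-2 : ℝ) • (y t).2 + (N (y t)).2) t) ∧
      Tendsto (fun t => exp (-t) • y t) atBot (𝓝 (u₀, 0)) := by
  set f : ℝ → E × F → E × F := fun x u => (2 * (x ^ 3)⁻¹) • N (x ^ 2 • u) with hf
  have hf0 : ∀ x, f x 0 = 0 := fun x => by simp [hf, hN0]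
  have hfl : ∀ x R u v, x ^ 2 * R < r → ‖u‖ ≤ R → ‖v‖ ≤ R →
      ‖f x u - f x v‖ ≤ 2 * C * R * |x| * ‖u - v‖ := by
    intro x R u v hx hu hv
    rcases eq_or_ne x 0 with rfl | hx0
    · simp [hf]
    have hn : ∀ w : E × F, ‖x ^ 2 • w‖ = x ^ 2 * ‖w‖ := fun w => by
      rw [norm_smul, Real.norm_of_nonneg (by positivity)]
    have h := hN (x ^ 2 • u) (x ^ 2 • v) (x ^ 2 * R) hx (by rw [hn]; gcongr) (by rw [hn]; gcongr)
    rw [← smul_sub, hn] at h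
    have habs : |x| ^ 2 = x ^ 2 := sq_abs x
    have hxp : 0 < |x| := abs_pos.2 hx0
    calc ‖f x u - f x v‖ = 2 * (|x| ^ 3)⁻¹ * ‖N (x ^ 2 • u) - N (x ^ 2 • v)‖ := by
          rw [hf, ← smul_sub, norm_smul]
          simp
      _ ≤ 2 * (|x| ^ 3)⁻¹ * (C * (x ^ 2 * R) * (x ^ 2 * ‖u - v‖)) := by gcongr
      _ = _ := by
        rw [← habs]
        field_simp
  have hfc : Continuous (Function.uncurry f) := by
    rw [continuous_iff_continuousAt]
    rintro ⟨x, u⟩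
    rcases eq_or_ne x 0 with rfl | hx0
    · have hval : Function.uncurry f (0, u) = 0 := by simp [hf]
      rw [ContinuousAt, hval]
      have hlim : Tendsto (fun p : ℝ × (E × F) => 2 * C * ‖p.2‖ * |p.1| * ‖p.2‖) (𝓝 (0, u))
          (𝓝 0) := by
        have : Continuous fun p : ℝ × (E × F) => 2 * C * ‖p.2‖ * |p.1| * ‖p.2‖ := by fun_prop
        simpa using this.tendsto (0, u)
      refine squeeze_zero_norm' ?_ hlim
      have hc : Continuous fun p : ℝ × (E × F) => p.1 ^ 2 * ‖p.2‖ := by fun_prop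
      have : ∀ᶠ p : ℝ × (E × F) in 𝓝 (0, u), p.1 ^ 2 * ‖p.2‖ < r :=
        hc.continuousAt.eventually_lt continuousAt_const (by simpa using hr)
      filter_upwards [this] with p hp
      have h := hfl p.1 ‖p.2‖ p.2 0 hp le_rfl (by simp)
      rw [hf0, sub_zero, sub_zero] at h
      exact h
    · have hx3 : x ^ 3 ≠ 0 := pow_ne_zero _ hx0
      simp only [hf, Function.uncurry_def]
      fun_prop (disch := assumption)
  set R : ℝ := ‖u₀‖ + 1 with hR
  have hR0 : 0 < R := by positivity
  have hR1 : 1 ≤ R := by simp [hR]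
  obtain ⟨d, hd0, hdr, hdC⟩ : ∃ d : ℝ, 0 < d ∧ d ^ 2 * R < r ∧ d * (2 * C * R * d) * R ≤ 1 / 2 := by
    have h1 : ∀ᶠ d : ℝ in 𝓝[>] 0, d ^ 2 * R < r := by
      have hc : Continuous fun d : ℝ => d ^ 2 * R := by fun_prop
      exact nhdsWithin_le_nhds
        (hc.continuousAt.eventually_lt continuousAt_const (by simpa using hr))
    have h2 : ∀ᶠ d : ℝ in 𝓝[>] 0, d * (2 * C * R * d) * R < 1 / 2 := by
      have hc : Continuous fun d : ℝ => d * (2 * C * R * d) * R := by fun_prop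
      exact nhdsWithin_le_nhds (hc.continuousAt.eventually_lt continuousAt_const (by simp))
    obtain ⟨d, hd, h1, h2⟩ := (eventually_mem_nhdsWithin.and (h1.and h2)).exists
    exact ⟨d, hd, h1, h2.le⟩
  have hdC' : d * (2 * C * R * d) ≤ 1 / 2 :=
    (le_mul_of_one_le_right (by positivity) hR1).trans hdC
  have hdle : (0 : ℝ) ≤ d := hd0.le
  let ext : C(Icc 0 d, E × F) → ℝ → E × F := fun u => IccExtend hdle u
  have hextc : ∀ u, Continuous (ext u) := fun u => u.continuous.Icc_extend'
  let g : C(Icc 0 d, E × F) → ℝ → E × F := fun u x => f x (ext u x)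
  have hgc : ∀ u, Continuous (g u) := fun u => by
    have : g u = Function.uncurry f ∘ fun x => (x, ext u x) := rfl
    rw [this]
    exact hfc.comp (continuous_id.prodMk (hextc u))
  let D : ℝ → E × F → E × F := fun s v => (v.1, s ^ 6 • v.2)
  have hDle : ∀ s ∈ Icc (0:ℝ) 1, ∀ v, ‖D s v‖ ≤ ‖v‖ := by
    intro s hs v
    refine max_le (norm_fst_le v) ?_
    rw [norm_smul, Real.norm_of_nonneg (pow_nonneg hs.1 _)]
    exact (mul_le_of_le_one_left (norm_nonneg _) (pow_le_one₀ hs.1 hs.2)).trans (norm_snd_le v)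
  have hDc : ∀ u, Continuous (Function.uncurry fun x s : ℝ => D s (g u (x * s))) := by
    intro u
    have := hgc u
    fun_prop
  let T : C(Icc 0 d, E × F) → C(Icc 0 d, E × F) := fun u =>
    ⟨fun x => (u₀, 0) + (x : ℝ) • ∫ s in (0:ℝ)..1, D s (g u (x * s)), by
      have h := intervalIntegral.continuous_parametric_intervalIntegral_of_continuous'
        (μ := volume) (hDc u) 0 1
      exact continuous_const.add (continuous_subtype_val.smul (h.comp continuous_subtype_val))⟩
  have hintble : ∀ u x, IntervalIntegrable (fun s => D s (g u (x * s))) volume 0 1 := fun u x =>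
    ((hDc u).comp (Continuous.prodMk_right x)).intervalIntegrable _ _
  set c₀ : C(Icc 0 d, E × F) := ContinuousMap.const _ (u₀, 0) with hc₀
  let S : Set C(Icc 0 d, E × F) := Metric.closedBall c₀ 1
  have hSR : ∀ u ∈ S, ∀ x, ‖ext u x‖ ≤ R := by
    intro u hu x
    have h1 : dist (ext u x) (u₀, 0) ≤ 1 :=
      (ContinuousMap.dist_apply_le_dist (f := u) (g := c₀) (projIcc 0 d hdle x)).trans hu
    have h2 : ‖((u₀, 0) : E × F)‖ = ‖u₀‖ := by simp [Prod.norm_def]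
    rw [dist_eq_norm] at h1
    linarith [norm_le_norm_add_norm_sub' (ext u x) (u₀, 0)]
  have hmem : ∀ x : Icc 0 d, ∀ s ∈ Icc (0:ℝ) 1, x * s ∈ Icc 0 d := fun x s hs =>
    ⟨mul_nonneg x.2.1 hs.1, (mul_le_of_le_one_right x.2.1 hs.2).trans x.2.2⟩
  have hbd : ∀ (x : Icc 0 d) (h : ℝ → E × F) (M : ℝ), 0 ≤ M →
      (∀ s ∈ Icc (0:ℝ) 1, ‖h s‖ ≤ M) → ‖(x : ℝ) • ∫ s in (0:ℝ)..1, h s‖ ≤ d * M := by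
    intro x h M hM hh
    rw [norm_smul, Real.norm_of_nonneg x.2.1]
    have := intervalIntegral.norm_integral_le_of_norm_le_const (a := 0) (b := 1) (f := h) (C := M)
      (fun s hs => hh s (by rw [uIoc_of_le zero_le_one] at hs; exact ⟨hs.1.le, hs.2⟩))
    rw [sub_zero, abs_one, mul_one] at this
    exact mul_le_mul x.2.2 this (norm_nonneg _) hdle
  have hgl : ∀ x ∈ Icc 0 d, ∀ u v : E × F, ‖u‖ ≤ R → ‖v‖ ≤ R →
      ‖f x u - f x v‖ ≤ 2 * C * R * d * ‖u - v‖ := by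
    intro x hx u v hu hv
    refine (hfl x R u v (lt_of_le_of_lt ?_ hdr) hu hv).trans ?_
    · have := hx.1
      have := hx.2
      gcongr
    · rw [abs_of_nonneg hx.1]
      have := hx.2
      gcongr
  have hmaps : MapsTo T S S := by
    intro u hu
    rw [Metric.mem_closedBall, ContinuousMap.dist_le zero_le_one]
    intro x
    have : T u x - c₀ x = (x : ℝ) • ∫ s in (0:ℝ)..1, D s (g u (x * s)) := add_sub_cancel_left _ _
    rw [dist_eq_norm, this]
    refine (hbd x _ (2 * C * R * d * R) (by positivity) fun s hs => ?_).trans (by linarith)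
    refine (hDle s hs _).trans ?_
    have h := hgl _ (hmem x s hs) (ext u (x * s)) 0 (hSR u hu _) (by simpa using hR0.le)
    rw [hf0, sub_zero, sub_zero] at h
    exact h.trans (by gcongr; exact hSR u hu _)
  have hcontr : ContractingWith (1 / 2) (hmaps.restrict T S S) := by
    refine ⟨by rw [← NNReal.coe_lt_coe]; norm_num, LipschitzWith.of_dist_le_mul ?_⟩
    rintro ⟨u, hu⟩ ⟨v, hv⟩
    change dist (T u) (T v) ≤ ((1 / 2 : NNReal) : ℝ) * dist u v
    rw [ContinuousMap.dist_le (by positivity)]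
    intro x
    have : T u x - T v x
        = (x : ℝ) • ∫ s in (0:ℝ)..1, (D s (g u (x * s)) - D s (g v (x * s))) := by
      rw [intervalIntegral.integral_sub (hintble u x) (hintble v x), smul_sub]
      exact add_sub_add_left_eq_sub _ _ _
    rw [dist_eq_norm, this]
    refine (hbd x _ (2 * C * R * d * dist u v) (by positivity) fun s hs => ?_).trans ?_
    · have hD : D s (g u (x * s)) - D s (g v (x * s)) = D s (g u (x * s) - g v (x * s)) := by
        simp [D, smul_sub]
      rw [hD]
      refine (hDle s hs _).trans ((hgl _ (hmem x s hs) _ _ (hSR u hu _) (hSR v hv _)).trans ?_)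
      gcongr
      rw [← dist_eq_norm]
      exact ContinuousMap.dist_apply_le_dist (f := u) (g := v) (projIcc 0 d hdle _)
    · rw [← mul_assoc]
      gcongr
      simpa using hdC'
  obtain ⟨u, -, hu, -⟩ := hcontr.exists_fixedPoint' (Metric.isClosed_closedBall.isComplete)
    hmaps (Metric.mem_closedBall_self zero_le_one : c₀ ∈ S) (edist_ne_top _ _)
  have hu1 : ∀ x ∈ Icc 0 d, ext u x = (u₀, 0) + x • ∫ s in (0:ℝ)..1, D s (g u (x * s)) := by
    intro x hx
    have h1 : ext u x = u ⟨x, hx⟩ := IccExtend_of_mem hdle u hx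
    rw [h1]
    conv_lhs => rw [← hu.eq]
    rfl
  have hfst : ∀ x ∈ Icc 0 d, (ext u x).1
      = u₀ + x • ∫ s in (0:ℝ)..1, s ^ 0 • (g u (x * s)).1 := by
    intro x hx
    have h := (ContinuousLinearMap.fst ℝ E F).intervalIntegral_comp_comm (hintble u x)
    rw [hu1 x hx]
    simp only [ContinuousLinearMap.coe_fst', D] at h
    simp only [Prod.fst_add, Prod.smul_fst, pow_zero, one_smul, h, D]
  have hsnd : ∀ x ∈ Icc 0 d, (ext u x).2 = x • ∫ s in (0:ℝ)..1, s ^ 6 • (g u (x * s)).2 := by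
    intro x hx
    have h := (ContinuousLinearMap.snd ℝ E F).intervalIntegral_comp_comm (hintble u x)
    rw [hu1 x hx]
    simp only [ContinuousLinearMap.coe_snd', D] at h
    simp only [Prod.snd_add, Prod.smul_snd, zero_add, h, D]
  have hd1 : ∀ x ∈ Ioo 0 d, HasDerivAt (fun x => (ext u x).1) (g u x).1 x := by
    intro x hx
    have h := (hasDerivAt_smul_integral_pow_smul (continuous_fst.comp (hgc u)) 0 hx.1).const_add u₀
    simp only [Nat.cast_zero, zero_div, zero_smul, sub_zero] at h
    refine h.congr_of_eventuallyEq ?_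
    filter_upwards [Ioo_mem_nhds hx.1 hx.2] with z hz
    exact hfst z (Ioo_subset_Icc_self hz)
  have hd2 : ∀ x ∈ Ioo 0 d, HasDerivAt (fun x => (ext u x).2)
      ((g u x).2 - (6 / x) • (ext u x).2) x := by
    intro x hx
    have h := hasDerivAt_smul_integral_pow_smul (continuous_snd.comp (hgc u)) 6 hx.1
    rw [hsnd x (Ioo_subset_Icc_self hx)]
    refine h.congr_of_eventuallyEq ?_
    filter_upwards [Ioo_mem_nhds hx.1 hx.2] with z hz
    exact hsnd z (Ioo_subset_Icc_self hz)
  refine ⟨2 * log d, fun t => exp t • ext u (exp (t / 2)), fun t ht => ?_, ?_⟩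
  · set x := exp (t / 2) with hx
    have hx2 : exp t = x ^ 2 := by rw [hx, ← exp_nat_mul]; congr 1; push_cast; ring
    have hxm : x ∈ Ioo 0 d := ⟨exp_pos _, by
      rw [hx, ← lt_log_iff_exp_lt hd0]; linarith⟩
    have hx0 : x ≠ 0 := hxm.1.ne'
    have he : HasDerivAt (fun t : ℝ => exp (t / 2)) (x / 2) t := by
      have := ((hasDerivAt_id t).div_const 2).exp
      simpa [div_eq_mul_inv, hx] using this
    have h := (hasDerivAt_exp t).smul
      (((hd1 x hxm).scomp t he).prodMk ((hd2 x hxm).scomp t he))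
    refine HasDerivAt.congr_deriv (f := fun t => exp t • ext u (exp (t / 2))) h ?_
    have hg : g u x = (2 * (x ^ 3)⁻¹) • N (x ^ 2 • ext u x) := rfl
    change exp t • ((x / 2) • (g u x).1, (x / 2) • ((g u x).2 - (6 / x) • (ext u x).2))
      + exp t • ((ext u x).1, (ext u x).2) = ((exp t • ext u x).1 + (N (exp t • ext u x)).1,
        (-2 : ℝ) • (exp t • ext u x).2 + (N (exp t • ext u x)).2)
    rw [hg, hx2]
    generalize N (x ^ 2 • ext u x) = n
    generalize ext u x = e
    ext1
    · simp only [Prod.fst_add, Prod.smul_fst, Prod.smul_mk, smul_smul]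
      match_scalars
      all_goals field_simp
    · simp only [Prod.snd_add, Prod.smul_snd, Prod.smul_mk, smul_smul, smul_sub]
      match_scalars
      all_goals field_simp
      all_goals norm_num
  · have h0 : ext u 0 = (u₀, 0) := by simpa using hu1 0 ⟨le_rfl, hdle⟩
    have h1 : Tendsto (fun t : ℝ => exp (t / 2)) atBot (𝓝 0) :=
      tendsto_exp_atBot.comp (tendsto_id.atBot_div_const two_pos)
    have h2 := ((hextc u).tendsto 0).comp h1
    rw [h0] at h2
    refine h2.congr fun t => ?_
    simp [smul_smul, ← exp_add]

theorem ContDiff.exists_norm_sub_le_mul {V W : Type*} [NormedAddCommGroup V] [NormedSpace ℝ V]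
    [NormedAddCommGroup W] [NormedSpace ℝ W] {N : V → W} (hN : ContDiff ℝ 2 N)
    (h0 : fderiv ℝ N 0 = 0) :
    ∃ C r : ℝ, 0 ≤ C ∧ 0 < r ∧ ∀ v w R, R < r → ‖v‖ ≤ R → ‖w‖ ≤ R →
      ‖N v - N w‖ ≤ C * R * ‖v - w‖ := by
  have h1 : ContDiff ℝ 1 (fderiv ℝ N) := hN.fderiv_right (by norm_num)
  obtain ⟨K, t, ht, hK⟩ := h1.contDiffAt.exists_lipschitzOnWith (x := 0)
  obtain ⟨r, hr, hrt⟩ := Metric.mem_nhds_iff.1 ht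
  refine ⟨K, r, K.2, hr, fun v w R hR hv hw => ?_⟩
  refine Convex.norm_image_sub_le_of_norm_fderiv_le (𝕜 := ℝ) (s := Metric.closedBall 0 R)
    (fun x _ => hN.differentiable (by norm_num) x) (fun x hx => ?_) (convex_closedBall 0 R)
    (by simpa using hw) (by simpa using hv)
  have h := hK.dist_le_mul x (hrt (Metric.closedBall_subset_ball hR hx)) 0
    (hrt (Metric.mem_ball_self hr))
  rw [h0, dist_zero_right, dist_zero_right] at h
  refine h.trans ?_
  gcongr
  simpa using hx

/-- A real-valued function that is both bounded and Lipschitz. -/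
def IsBoundedLipschitz {X : Type*} [PseudoMetricSpace X] (f : X → ℝ) : Prop :=
  ∃ M : ℝ, (∀ x, |f x| ≤ M) ∧ ∀ x y, |f x - f y| ≤ M * dist x y

namespace IsBoundedLipschitz

variable {X : Type*} [PseudoMetricSpace X] {f g : X → ℝ}

theorem mk' {B L : ℝ} (hB : ∀ x, |f x| ≤ B) (hL : ∀ x y, |f x - f y| ≤ L * dist x y) :
    IsBoundedLipschitz f :=
  ⟨max B L, fun x => (hB x).trans (le_max_left _ _), fun x y =>
    (hL x y).trans (mul_le_mul_of_nonneg_right (le_max_right _ _) dist_nonneg)⟩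

theorem add (hf : IsBoundedLipschitz f) (hg : IsBoundedLipschitz g) :
    IsBoundedLipschitz fun x => f x + g x := by
  obtain ⟨M, hM, hM'⟩ := hf
  obtain ⟨P, hP, hP'⟩ := hg
  refine ⟨M + P, fun x => (abs_add_le _ _).trans (add_le_add (hM x) (hP x)), fun x y => ?_⟩
  rw [add_sub_add_comm, add_mul]
  exact (abs_add_le _ _).trans (add_le_add (hM' x y) (hP' x y))

theorem mul (hf : IsBoundedLipschitz f) (hg : IsBoundedLipschitz g) :
    IsBoundedLipschitz fun x => f x * g x := by
  obtain ⟨M, hM, hM'⟩ := hf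
  obtain ⟨P, hP, hP'⟩ := hg
  refine mk' (B := M * P) (L := M * P + M * P) (fun x => ?_) fun x y => ?_
  · rw [abs_mul]
    exact mul_le_mul (hM x) (hP x) (abs_nonneg _) ((abs_nonneg _).trans (hM x))
  · have : f x * g x - f y * g y = (f x - f y) * g x + f y * (g x - g y) := by ring
    rw [this]
    refine (abs_add_le _ _).trans ?_
    rw [abs_mul, abs_mul]
    have h1 := mul_le_mul (hM' x y) (hP x) (abs_nonneg _) ((abs_nonneg _).trans (hM' x y))
    have h2 := mul_le_mul (hM y) (hP' x y) (abs_nonneg _) ((abs_nonneg _).trans (hM y))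
    linarith

theorem const (a : ℝ) : IsBoundedLipschitz fun _ : X => a :=
  mk' (B := |a|) (L := 0) (fun _ => le_rfl) fun x y => by simp

theorem sub (hf : IsBoundedLipschitz f) (hg : IsBoundedLipschitz g) :
    IsBoundedLipschitz fun x => f x - g x := by
  have := hf.add ((const (-1)).mul hg)
  simpa [sub_eq_add_neg] using this

theorem inv (hf : IsBoundedLipschitz f) {m : ℝ} (hm : 0 < m) (h : ∀ x, m ≤ f x) :
    IsBoundedLipschitz fun x => (f x)⁻¹ := by
  obtain ⟨M, hM, hM'⟩ := hf
  refine mk' (B := m⁻¹) (L := m⁻¹ * m⁻¹ * M) (fun x => ?_) fun x y => ?_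
  · have := hm.trans_le (h x)
    rw [abs_of_pos (inv_pos.2 this)]
    exact inv_anti₀ hm (h x)
  · have hx := hm.trans_le (h x)
    have hy := hm.trans_le (h y)
    rw [inv_sub_inv hx.ne' hy.ne', abs_div, abs_of_pos (mul_pos hx hy), abs_sub_comm,
      div_eq_inv_mul, mul_inv, mul_assoc _ M]
    have h1 := inv_anti₀ hm (h x)
    have h2 := inv_anti₀ hm (h y)
    have h3 := hM' x y
    gcongr

theorem comp {Y : Type*} [PseudoMetricSpace Y] {φ : Y → X} {K : NNReal}
    (hf : IsBoundedLipschitz f) (hφ : LipschitzWith K φ) :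
    IsBoundedLipschitz fun y => f (φ y) := by
  obtain ⟨M, hM, hM'⟩ := hf
  refine mk' (B := M) (L := M * K) (fun y => hM _) fun x y => (hM' _ _).trans ?_
  rw [mul_assoc]
  exact mul_le_mul_of_nonneg_left (hφ.dist_le_mul x y) ((abs_nonneg _).trans (hM (φ x)))

theorem exists_lipschitzWith (hf : IsBoundedLipschitz f) : ∃ K, LipschitzWith K f := by
  obtain ⟨M, hM, hM'⟩ := hf
  refine ⟨M.toNNReal, LipschitzWith.of_dist_le_mul fun x y => (hM' x y).trans ?_⟩
  gcongr
  exact le_coe_toNNReal M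

theorem of_hasDerivAt {f f' : ℝ → ℝ} {B L : ℝ} (hf : ∀ x, HasDerivAt f (f' x) x)
    (hB : ∀ x, |f x| ≤ B) (hL : ∀ x, |f' x| ≤ L) : IsBoundedLipschitz f := by
  refine mk' hB (L := L) fun x y => ?_
  have := Convex.norm_image_sub_le_of_norm_hasDerivWithin_le (s := univ)
    (fun x _ => (hf x).hasDerivWithinAt) (fun x _ => hL x) convex_univ (mem_univ y) (mem_univ x)
  simpa [dist_eq_norm] using this

end IsBoundedLipschitz

theorem hasDerivAt_tanh (x : ℝ) : HasDerivAt tanh (1 - tanh x ^ 2) x := by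
  have h := (hasDerivAt_sinh x).div (hasDerivAt_cosh x) (cosh_pos x).ne'
  have hf : tanh = sinh / cosh := funext tanh_eq_sinh_div_cosh
  rw [hf]
  refine h.congr_deriv ?_
  have := (cosh_pos x).ne'
  simp only [Pi.div_apply]
  field_simp

theorem hasDerivAt_inv_cosh (x : ℝ) :
    HasDerivAt (fun x => (cosh x)⁻¹) (-(tanh x * (cosh x)⁻¹)) x := by
  refine ((hasDerivAt_cosh x).fun_inv (cosh_pos x).ne').congr_deriv ?_
  have := (cosh_pos x).ne'
  rw [tanh_eq_sinh_div_cosh]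
  field_simp

theorem inv_cosh_sq (x : ℝ) : (cosh x)⁻¹ ^ 2 = 1 - tanh x ^ 2 := by
  have := (cosh_pos x).ne'
  rw [tanh_eq_sinh_div_cosh]
  field_simp
  linarith [cosh_sq x]

theorem isBoundedLipschitz_tanh : IsBoundedLipschitz tanh := by
  refine .of_hasDerivAt hasDerivAt_tanh (B := 1) (L := 1) (fun x => (abs_tanh_lt_one x).le)
    fun x => ?_
  rw [abs_of_pos (by linarith [tanh_sq_lt_one x])]
  linarith [sq_nonneg (tanh x)]

theorem isBoundedLipschitz_inv_cosh : IsBoundedLipschitz fun x => (cosh x)⁻¹ := by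
  have h : ∀ x, |(cosh x)⁻¹| ≤ 1 := fun x => by
    rw [abs_of_pos (inv_pos.2 (cosh_pos x))]
    exact inv_le_one_of_one_le₀ (one_le_cosh x)
  refine .of_hasDerivAt hasDerivAt_inv_cosh (B := 1) (L := 1) h fun x => ?_
  rw [abs_neg, abs_mul]
  exact mul_le_one₀ (abs_tanh_lt_one x).le (abs_nonneg _) (h x)

theorem isBoundedLipschitz_sin : IsBoundedLipschitz sin :=
  .of_hasDerivAt hasDerivAt_sin (B := 1) (L := 1) abs_sin_le_one abs_cos_le_one

theorem contDiff_tanh {n : WithTop ℕ∞} : ContDiff ℝ n tanh := by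
  have hf : tanh = fun x => sinh x / cosh x := funext tanh_eq_sinh_div_cosh
  rw [hf]
  exact contDiff_sinh.div contDiff_cosh fun x => (cosh_pos x).ne'

theorem one_sub_two_mul_mul_sin_sq_pos {α : ℝ} (hα0 : 0 < α) (hα : α < 1 / 2) (x : ℝ) :
    1 - 2 * α ≤ 1 - 2 * α * sin x ^ 2 ∧ 0 < 1 - 2 * α * sin x ^ 2 := by
  have := mul_le_mul_of_nonneg_left (sin_sq_le_one x) (by linarith : (0 : ℝ) ≤ 2 * α)
  constructor <;> linarith

/-- The coordinate `h` in terms of the eigencoordinates at the fixed point. -/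
def hCoord (α : ℝ) (v : (ℝ × ℝ × ℝ) × ℝ) : ℝ := (v.1.1 + v.2) * (3 * √α)⁻¹

/-- The coordinate `θ` in terms of the eigencoordinates at the fixed point. -/
def θCoord (v : (ℝ × ℝ × ℝ) × ℝ) : ℝ := (v.1.1 - 2 * v.2) * 3⁻¹

/-- The regularised vector field of the CSS system, in eigencoordinates at the fixed point. -/
def cssField (α : ℝ) (v : (ℝ × ℝ × ℝ) × ℝ) : (ℝ × ℝ × ℝ) × ℝ :=
  ((2 * (tanh (θCoord v) * (cosh v.1.2.1)⁻¹) +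
      (√α * (sin (2 * hCoord α v) * (1 - 2 * α * (sin (hCoord α v) * sin (hCoord α v)))⁻¹) *
        (cosh v.1.2.1)⁻¹ - tanh (θCoord v)),
    tanh v.1.2.1 * (1 + tanh (θCoord v) * tanh (θCoord v)),
    tanh v.1.2.2 * ((cosh v.1.2.1)⁻¹ * (cosh v.1.2.1)⁻¹)),
  tanh (θCoord v) * (cosh v.1.2.1)⁻¹ -
    (√α * (sin (2 * hCoord α v) * (1 - 2 * α * (sin (hCoord α v) * sin (hCoord α v)))⁻¹) *
      (cosh v.1.2.1)⁻¹ - tanh (θCoord v)))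

theorem contDiff_cssField {α : ℝ} (hα0 : 0 < α) (hα : α < 1 / 2) {n : WithTop ℕ∞} :
    ContDiff ℝ n (cssField α) := by
  have h1 : ∀ x, 1 - 2 * α * (sin x * sin x) ≠ 0 := fun x => by
    have := (one_sub_two_mul_mul_sin_sq_pos hα0 hα x).2
    rw [← sq]
    exact this.ne'
  have h2 : ∀ x, cosh x ≠ 0 := fun x => (cosh_pos x).ne'
  have hh : ContDiff ℝ n (hCoord α) := by unfold hCoord; fun_prop
  have hθ : ContDiff ℝ n θCoord := by unfold θCoord; fun_prop
  have ht : ContDiff ℝ n fun v => tanh (θCoord v) := contDiff_tanh.comp hθ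
  have hy : ContDiff ℝ n fun v : (ℝ × ℝ × ℝ) × ℝ => tanh v.1.2.1 := contDiff_tanh.comp (by fun_prop)
  have hκ : ContDiff ℝ n fun v : (ℝ × ℝ × ℝ) × ℝ => tanh v.1.2.2 := contDiff_tanh.comp (by fun_prop)
  have hc : ContDiff ℝ n fun v : (ℝ × ℝ × ℝ) × ℝ => (cosh v.1.2.1)⁻¹ :=
    ContDiff.inv (by fun_prop) fun v => h2 _
  have hd : ContDiff ℝ n fun v => (1 - 2 * α * (sin (hCoord α v) * sin (hCoord α v)))⁻¹ :=
    ContDiff.inv (by fun_prop) fun v => h1 _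
  unfold cssField
  fun_prop

theorem exists_lipschitzWith_cssField {α : ℝ} (hα0 : 0 < α) (hα : α < 1 / 2) :
    ∃ K, LipschitzWith K (cssField α) := by
  have lip : ∀ ℓ : (ℝ × ℝ × ℝ) × ℝ →L[ℝ] ℝ, LipschitzWith ‖ℓ‖₊ ℓ := fun ℓ => ℓ.lipschitz
  set ℓp : (ℝ × ℝ × ℝ) × ℝ →L[ℝ] ℝ := .comp (.fst ℝ _ _) (.fst ℝ _ _)
  set ℓq : (ℝ × ℝ × ℝ) × ℝ →L[ℝ] ℝ := .snd ℝ _ _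
  have hh : hCoord α = ⇑((3 * √α)⁻¹ • (ℓp + ℓq)) := by
    ext v
    simp [hCoord, ℓp, ℓq]
    ring
  have h2h : (fun v => 2 * hCoord α v) = ⇑((2 * (3 * √α)⁻¹) • (ℓp + ℓq)) := by
    ext v
    simp [hCoord, ℓp, ℓq]
    ring
  have hθ : θCoord = ⇑((3 : ℝ)⁻¹ • (ℓp - (2 : ℝ) • ℓq)) := by
    ext v
    simp [θCoord, ℓp, ℓq, mul_comm]
  have hs : IsBoundedLipschitz fun v => sin (hCoord α v) := by
    rw [hh]; exact isBoundedLipschitz_sin.comp (lip _)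
  have hs2 : IsBoundedLipschitz fun v => sin (2 * hCoord α v) := by
    have := isBoundedLipschitz_sin.comp (lip ((2 * (3 * √α)⁻¹) • (ℓp + ℓq)))
    rwa [← h2h] at this
  have ht : IsBoundedLipschitz fun v => tanh (θCoord v) := by
    rw [hθ]; exact isBoundedLipschitz_tanh.comp (lip _)
  have hy : IsBoundedLipschitz fun v : (ℝ × ℝ × ℝ) × ℝ => tanh v.1.2.1 :=
    isBoundedLipschitz_tanh.comp
      (lip (.comp (.fst ℝ ℝ ℝ) (.comp (.snd ℝ ℝ (ℝ × ℝ)) (.fst ℝ _ ℝ))))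
  have hκ : IsBoundedLipschitz fun v : (ℝ × ℝ × ℝ) × ℝ => tanh v.1.2.2 :=
    isBoundedLipschitz_tanh.comp
      (lip (.comp (.snd ℝ ℝ ℝ) (.comp (.snd ℝ ℝ (ℝ × ℝ)) (.fst ℝ _ ℝ))))
  have hc : IsBoundedLipschitz fun v : (ℝ × ℝ × ℝ) × ℝ => (cosh v.1.2.1)⁻¹ :=
    isBoundedLipschitz_inv_cosh.comp
      (lip (.comp (.fst ℝ ℝ ℝ) (.comp (.snd ℝ ℝ (ℝ × ℝ)) (.fst ℝ _ ℝ))))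
  have hd : IsBoundedLipschitz
      fun v => (1 - 2 * α * (sin (hCoord α v) * sin (hCoord α v)))⁻¹ :=
    ((IsBoundedLipschitz.const 1).sub ((IsBoundedLipschitz.const (2 * α)).mul (hs.mul hs))).inv
      (m := 1 - 2 * α) (by linarith) fun v => by
        rw [← sq]; exact (one_sub_two_mul_mul_sin_sq_pos hα0 hα _).1
  have hP := (((IsBoundedLipschitz.const (√α)).mul (hs2.mul hd)).mul hc).sub ht
  obtain ⟨K₁, h₁⟩ := (((IsBoundedLipschitz.const 2).mul (ht.mul hc)).add hP).exists_lipschitzWith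
  obtain ⟨K₂, h₂⟩ :=
    (hy.mul ((IsBoundedLipschitz.const 1).add (ht.mul ht))).exists_lipschitzWith
  obtain ⟨K₃, h₃⟩ := (hκ.mul (hc.mul hc)).exists_lipschitzWith
  obtain ⟨K₄, h₄⟩ := ((ht.mul hc).sub hP).exists_lipschitzWith
  exact ⟨_, (h₁.prodMk (h₂.prodMk h₃)).prodMk h₄⟩

theorem hasFDerivAt_cssField {α : ℝ} (hα0 : 0 < α) (hα : α < 1 / 2) :
    HasFDerivAt (cssField α)
      ((ContinuousLinearMap.fst ℝ (ℝ × ℝ × ℝ) ℝ).prod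
        ((-2 : ℝ) • ContinuousLinearMap.snd ℝ (ℝ × ℝ × ℝ) ℝ)) 0 := by
  have hd : DifferentiableAt ℝ (cssField α) 0 :=
    (contDiff_cssField hα0 hα (n := 1)).differentiable (by norm_num) 0
  convert hd.hasFDerivAt using 1
  refine ContinuousLinearMap.ext fun v => ?_
  have hline : HasDerivAt (fun t : ℝ => t • v) v 0 := by
    simpa using (hasDerivAt_id (0 : ℝ)).smul_const v
  have hd0 : HasFDerivAt (cssField α) (fderiv ℝ (cssField α) 0) ((0 : ℝ) • v) := by
    rw [zero_smul]
    exact hd.hasFDerivAt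
  have hcomp : HasDerivAt (fun t : ℝ => cssField α (t • v)) (fderiv ℝ (cssField α) 0 v) 0 :=
    HasFDerivAt.comp_hasDerivAt (f := fun t : ℝ => t • v) 0 hd0 hline
  refine HasDerivAt.unique ?_ hcomp
  have hlin : ∀ a : ℝ, HasDerivAt (fun t : ℝ => t * a) a 0 := fun a => by
    simpa using (hasDerivAt_id (0 : ℝ)).mul_const a
  have hcos : ∀ f : ℝ → ℝ, ∀ f', f 0 = 0 → HasDerivAt f f' 0 →
      HasDerivAt (fun t => (cosh (f t))⁻¹) 0 0 := fun f f' h0 hf => by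
    have := (hasDerivAt_inv_cosh (f 0)).comp 0 hf
    simpa [h0, Function.comp_def] using this
  have htan : ∀ f : ℝ → ℝ, ∀ f', f 0 = 0 → HasDerivAt f f' 0 →
      HasDerivAt (fun t => tanh (f t)) f' 0 := fun f f' h0 hf => by
    have := (hasDerivAt_tanh (f 0)).comp 0 hf
    simpa [h0, Function.comp_def] using this
  have hsin : ∀ f : ℝ → ℝ, ∀ f', f 0 = 0 → HasDerivAt f f' 0 →
      HasDerivAt (fun t => sin (f t)) f' 0 := fun f f' h0 hf => by
    have := (hasDerivAt_sin (f 0)).comp 0 hf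
    simpa [h0, Function.comp_def] using this
  have hh : HasDerivAt (fun t : ℝ => hCoord α (t • v)) (hCoord α v) 0 := by
    refine (hlin (hCoord α v)).congr_of_eventuallyEq (.of_forall fun t => ?_)
    simp [hCoord]
    ring
  have hθ : HasDerivAt (fun t : ℝ => θCoord (t • v)) (θCoord v) 0 := by
    refine (hlin (θCoord v)).congr_of_eventuallyEq (.of_forall fun t => ?_)
    simp [θCoord]
    ring
  have hT := htan _ _ (by simp [θCoord]) hθ
  have hC := hcos (fun t : ℝ => (t • v).1.2.1) v.1.2.1 (by simp) (hlin _)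
  have hY := htan (fun t : ℝ => (t • v).1.2.1) v.1.2.1 (by simp) (hlin _)
  have hK := htan (fun t : ℝ => (t • v).1.2.2) v.1.2.2 (by simp) (hlin _)
  have hS := hsin _ _ (by simp [hCoord]) hh
  have hS2 := hsin _ _ (by simp [hCoord]) (hh.const_mul 2)
  have hD := (((hS.mul hS).const_mul (2 * α)).const_sub 1).fun_inv (by simp [hCoord])
  have hP := (((hS2.mul hD).const_mul (√α)).mul hC).sub hT
  have hG := (((((hT.mul hC).const_mul 2).add hP).prodMk
    ((hY.mul ((hT.mul hT).const_add 1)).prodMk (hK.mul (hC.mul hC))))).prodMk ((hT.mul hC).sub hP)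
  refine HasDerivAt.congr_deriv (f := fun t : ℝ => cssField α (t • v)) hG ?_
  have hα' : √α ≠ 0 := (sqrt_pos.2 hα0).ne'
  refine Prod.ext (Prod.ext ?_ (Prod.ext ?_ ?_)) ?_ <;> simp [hCoord, θCoord] <;> field_simp <;>
    ring

theorem LipschitzWith.exists_forall_hasDerivAt_of_forall_lt {E : Type*} [NormedAddCommGroup E]
    [NormedSpace ℝ E] [CompleteSpace E] {G : E → E} {K : NNReal} (hG : LipschitzWith K G)
    {y : ℝ → E} {a : ℝ} (hy : ∀ t < a, HasDerivAt y (G (y t)) t) :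
    ∃ x : ℝ → E, (∀ t, HasDerivAt x (G (x t)) t) ∧ ∀ t < a, x t = y t := by
  obtain ⟨x, hx0, hx⟩ := hG.exists_forall_hasDerivAt (y (a - 1)) (a - 1)
  refine ⟨x, hx, fun t ht => ?_⟩
  set l := min t (a - 1) - 1 with hl
  have h1 := min_le_left t (a - 1)
  have h2 := min_le_right t (a - 1)
  exact ODE_solution_unique_of_mem_Ioo (v := fun _ => G) (s := fun _ => univ) (K := K)
    (a := l) (b := a) (t₀ := a - 1)
    (fun _ _ => hG.lipschitzOnWith) ⟨by linarith, by linarith⟩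
    (fun s _ => ⟨hx s, mem_univ _⟩) (fun s hs => ⟨hy s hs.2, mem_univ _⟩) hx0
    ⟨by linarith, ht⟩

theorem exists_css_flow {α : ℝ} (hα0 : 0 < α) (hα : α < 1 / 2) (c : ℝ) :
    ∃ h θ y κ : ℝ → ℝ,
      (∀ t, HasDerivAt h (tanh (θ t) * (cosh (y t))⁻¹ / √α) t) ∧
      (∀ t, HasDerivAt θ (√α * (sin (2 * h t) / (1 - 2 * α * sin (h t) ^ 2)) * (cosh (y t))⁻¹
        - tanh (θ t)) t) ∧
      (∀ t, HasDerivAt y (tanh (y t) * (1 + tanh (θ t) ^ 2)) t) ∧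
      (∀ t, HasDerivAt κ (tanh (κ t) * (cosh (y t))⁻¹ ^ 2) t) ∧
      Tendsto (fun t => exp (-t) * h t) atBot (𝓝 c) ∧
      Tendsto (fun t => exp (-t) * θ t) atBot (𝓝 (√α * c)) ∧
      Tendsto (fun t => exp (-t) * y t) atBot (𝓝 1) ∧
      Tendsto (fun t => exp (-t) * κ t) atBot (𝓝 1) := by
  set L := (ContinuousLinearMap.fst ℝ (ℝ × ℝ × ℝ) ℝ).prod
        ((-2 : ℝ) • ContinuousLinearMap.snd ℝ (ℝ × ℝ × ℝ) ℝ) with hL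
  have hs0 : √α ≠ 0 := (sqrt_pos.2 hα0).ne'
  have hN : ContDiff ℝ 2 fun v => cssField α v - L v := (contDiff_cssField hα0 hα).sub L.contDiff
  have hN' : fderiv ℝ (fun v => cssField α v - L v) 0 = 0 := by
    have := ((hasFDerivAt_cssField hα0 hα).fun_sub L.hasFDerivAt).fderiv
    rw [this, sub_self]
  obtain ⟨C, r, hC, hr, hq⟩ := hN.exists_norm_sub_le_mul hN'
  obtain ⟨a, z, hz, hz0⟩ := exists_tangent_solution hN.continuous
    (by simp [cssField, hCoord, θCoord]) hC hr hq (3 * √α * c, 1, 1)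
  obtain ⟨K, hK⟩ := exists_lipschitzWith_cssField hα0 hα
  obtain ⟨x, hx, hxz⟩ := hK.exists_forall_hasDerivAt_of_forall_lt (y := z) (a := a)
    fun t ht => (hz t ht).congr_deriv (by ext1 <;> simp [hL])
  have hx0 : Tendsto (fun t => exp (-t) • x t) atBot (𝓝 ((3 * √α * c, 1, 1), 0)) := by
    refine hz0.congr' ?_
    filter_upwards [eventually_lt_atBot a] with t ht
    rw [hxz t ht]
  have hp : ∀ t, HasDerivAt (fun t => (x t).1.1) (cssField α (x t)).1.1 t := fun t => (hx t).fst.fst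
  have hq : ∀ t, HasDerivAt (fun t => (x t).2) (cssField α (x t)).2 t := fun t => (hx t).snd
  have hy : ∀ t, HasDerivAt (fun t => (x t).1.2.1) (cssField α (x t)).1.2.1 t :=
    fun t => (hx t).fst.snd.fst
  have hκ : ∀ t, HasDerivAt (fun t => (x t).1.2.2) (cssField α (x t)).1.2.2 t :=
    fun t => (hx t).fst.snd.snd
  have hp0 : Tendsto (fun t => exp (-t) * (x t).1.1) atBot (𝓝 (3 * √α * c)) :=
    ((continuous_fst.comp continuous_fst).tendsto _).comp hx0
  have hq0 : Tendsto (fun t => exp (-t) * (x t).2) atBot (𝓝 0) :=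
    (continuous_snd.tendsto _).comp hx0
  refine ⟨fun t => hCoord α (x t), fun t => θCoord (x t), fun t => (x t).1.2.1,
    fun t => (x t).1.2.2, fun t => ?_, fun t => ?_, fun t => ?_, fun t => ?_, ?_, ?_,
    ((continuous_fst.comp (continuous_snd.comp continuous_fst)).tendsto _).comp hx0,
    ((continuous_snd.comp (continuous_snd.comp continuous_fst)).tendsto _).comp hx0⟩
  · refine (((hp t).add (hq t)).mul_const _).congr_deriv ?_
    simp only [cssField]
    field_simp
    ring
  · refine (((hp t).sub ((hq t).const_mul 2)).mul_const _).congr_deriv ?_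
    simp only [cssField, ← sq]
    ring
  · refine (hy t).congr_deriv ?_
    simp only [cssField, ← sq]
  · refine (hκ t).congr_deriv ?_
    simp only [cssField, ← sq]
  · convert (hp0.add hq0).mul_const (3 * √α)⁻¹ using 2
    · simp only [hCoord]
      ring
    · field_simp
      ring
  · convert (hp0.sub (hq0.const_mul 2)).mul_const (3 : ℝ)⁻¹ using 2
    · simp only [θCoord]
      ring
    · ring

/-- The CSS system in the regular time variable `t` with `dρ/dt = (1 - Z ^ 2) * ρ`, where
`h = H + π / 2`, `m = √(1 - Z ^ 2)` and `V = ρ * H' * m`, with the asymptotics of the `c`-orbit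
as `t → -∞`. -/
structure IsRegularFlow (α c : ℝ) (h V Z m ρ A : ℝ → ℝ) : Prop where
  hasDerivAt_h : ∀ t, HasDerivAt h (V t * m t) t
  hasDerivAt_V : ∀ t, HasDerivAt V
    ((1 - α * V t ^ 2) * (sin (2 * h t) / (1 - 2 * α * sin (h t) ^ 2) * m t - V t)) t
  hasDerivAt_Z : ∀ t, HasDerivAt Z (Z t * ((1 + α * V t ^ 2) * m t ^ 2)) t
  hasDerivAt_m : ∀ t, HasDerivAt m (-(Z t ^ 2 * (1 + α * V t ^ 2) * m t)) t
  hasDerivAt_ρ : ∀ t, HasDerivAt ρ (ρ t * m t ^ 2) t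
  hasDerivAt_A : ∀ t, HasDerivAt A (-(2 * α * A t * V t ^ 2)) t
  m_pos : ∀ t, 0 < m t
  m_sq : ∀ t, m t ^ 2 = 1 - Z t ^ 2
  V_sq_lt : ∀ t, α * V t ^ 2 < 1
  constraint : ∀ t, A t * (1 - α * V t ^ 2) = 1 - 2 * α * sin (h t) ^ 2
  tendsto_h : Tendsto (fun t => exp (-t) * h t) atBot (𝓝 c)
  tendsto_V : Tendsto (fun t => exp (-t) * V t) atBot (𝓝 c)
  tendsto_Z : Tendsto (fun t => exp (-t) * Z t) atBot (𝓝 1)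
  tendsto_ρ : Tendsto (fun t => exp (-t) * ρ t) atBot (𝓝 1)

theorem tendsto_zero_of_tendsto_exp_neg_mul {f : ℝ → ℝ} {l : ℝ}
    (hf : Tendsto (fun t => exp (-t) * f t) atBot (𝓝 l)) : Tendsto f atBot (𝓝 0) := by
  have := tendsto_exp_atBot.mul hf
  rw [zero_mul] at this
  refine this.congr fun t => ?_
  rw [← mul_assoc, ← exp_add]
  simp

theorem tendsto_exp_neg_mul_comp {φ : ℝ → ℝ} {φ' : ℝ} (hφ : HasDerivAt φ φ' 0)
    (h0 : φ 0 = 0) {f : ℝ → ℝ} {l : ℝ} (hf : Tendsto (fun t => exp (-t) * f t) atBot (𝓝 l)) :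
    Tendsto (fun t => exp (-t) * φ (f t)) atBot (𝓝 (l * φ')) := by
  have h1 : Tendsto (fun t => dslope φ 0 (f t)) atBot (𝓝 φ') := by
    have := (continuousAt_dslope_same.2 hφ.differentiableAt).tendsto
    rw [dslope_same, hφ.deriv] at this
    exact this.comp (tendsto_zero_of_tendsto_exp_neg_mul hf)
  refine (hf.mul h1).congr fun t => ?_
  have := sub_smul_dslope φ 0 (f t)
  rw [sub_zero, h0, sub_zero, smul_eq_mul] at this
  rw [mul_assoc, this]

theorem exists_isRegularFlow {α : ℝ} (hα0 : 0 < α) (hα : α < 1 / 2) (c : ℝ) :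
    ∃ h V Z m ρ A : ℝ → ℝ, IsRegularFlow α c h V Z m ρ A := by
  obtain ⟨h, θ, y, κ, hh, hθ, hy, hκ, hh0, hθ0, hy0, hκ0⟩ := exists_css_flow hα0 hα c
  have hs0 : √α ≠ 0 := (sqrt_pos.2 hα0).ne'
  have hsq : √α ^ 2 = α := sq_sqrt hα0.le
  have hV2 : ∀ t, α * (tanh (θ t) / √α) ^ 2 = tanh (θ t) ^ 2 := fun t => by
    rw [div_pow, hsq]
    field_simp
  have hsum : ∀ t, 1 - 2 * α * sin (h t) ^ 2 ≠ 0 := fun t =>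
    (one_sub_two_mul_mul_sin_sq_pos hα0 hα _).2.ne'
  have hcosh : ∀ x, cosh x ^ 2 * (1 - tanh x ^ 2) = 1 := fun x => by
    rw [← inv_cosh_sq, ← mul_pow, mul_inv_cancel₀ (cosh_pos x).ne', one_pow]
  refine ⟨h, fun t => tanh (θ t) / √α, fun t => tanh (y t), fun t => (cosh (y t))⁻¹,
    fun t => sinh (κ t), fun t => (1 - 2 * α * sin (h t) ^ 2) * cosh (θ t) ^ 2, ?_⟩
  constructor
  · intro t
    refine (hh t).congr_deriv ?_
    ring
  · intro t
    refine (((hasDerivAt_tanh (θ t)).comp t (hθ t)).div_const (√α)).congr_deriv ?_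
    rw [hV2]
    field_simp
  · intro t
    refine ((hasDerivAt_tanh (y t)).comp t (hy t)).congr_deriv ?_
    rw [hV2, inv_cosh_sq]
    ring
  · intro t
    refine ((hasDerivAt_inv_cosh (y t)).comp t (hy t)).congr_deriv ?_
    rw [hV2]
    ring
  · intro t
    refine ((hasDerivAt_sinh (κ t)).comp t (hκ t)).congr_deriv ?_
    have := (cosh_pos (κ t)).ne'
    rw [tanh_eq_sinh_div_cosh]
    field_simp
  · intro t
    have h1 := ((((hasDerivAt_sin (h t)).comp t (hh t)).fun_pow 2).const_mul (2 * α)).const_sub 1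
    have h2 := ((hasDerivAt_cosh (θ t)).comp t (hθ t)).fun_pow 2
    refine (h1.fun_mul h2).congr_deriv ?_
    have h3 := hsum t
    have h4 : sinh (θ t) = cosh (θ t) * tanh (θ t) := by
      rw [tanh_eq_sinh_div_cosh, mul_div_cancel₀ _ (cosh_pos _).ne']
    have h5 : 2 * α * ((1 - 2 * α * sin (h t) ^ 2) * cosh (θ t) ^ 2) * (tanh (θ t) / √α) ^ 2
        = 2 * ((1 - 2 * α * sin (h t) ^ 2) * cosh (θ t) ^ 2) * tanh (θ t) ^ 2 := by
      rw [← hV2]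
      ring
    have h6 : 2 * α * (2 * sin (h t) * (cos (h t) * (tanh (θ t) * (cosh (y t))⁻¹ / √α)))
        = 2 * √α * (2 * sin (h t) * (cos (h t) * (tanh (θ t) * (cosh (y t))⁻¹))) := by
      have := (cosh_pos (y t)).ne'
      field_simp
      linear_combination (-sin (h t) * cos (h t) * tanh (θ t)) * hsq
    simp only [Function.comp_apply, Nat.cast_ofNat, Nat.add_one_sub_one, pow_one]
    rw [h4, h5, h6, sin_two_mul]
    generalize 1 - 2 * α * sin (h t) ^ 2 = d at h3 ⊢
    field_simp
    ring
  · exact fun t => inv_pos.2 (cosh_pos _)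
  · exact fun t => inv_cosh_sq _
  · intro t
    rw [hV2]
    exact tanh_sq_lt_one _
  · intro t
    rw [hV2, mul_assoc, hcosh, mul_one]
  · exact hh0
  · have := (tendsto_exp_neg_mul_comp (hasDerivAt_tanh 0) tanh_zero hθ0).div_const (√α)
    convert this using 2
    · ring
    · simp
      field_simp
  · simpa using tendsto_exp_neg_mul_comp (hasDerivAt_tanh 0) tanh_zero hy0
  · simpa using tendsto_exp_neg_mul_comp (hasDerivAt_sinh 0) sinh_zero hκ0

theorem pos_of_hasDerivAt_mul {D g : ℝ → ℝ} (hg : Continuous g)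
    (hD : ∀ t, HasDerivAt D (D t * g t) t) {t₀ : ℝ} (h : 0 < D t₀) (t : ℝ) : 0 < D t := by
  set I : ℝ → ℝ := fun s => ∫ u in t₀..s, g u
  have hI : ∀ s, HasDerivAt I (g s) s := fun s => hg.integral_hasStrictDerivAt t₀ s |>.hasDerivAt
  have hconst : ∀ s, HasDerivAt (fun s => D s * exp (-I s)) 0 s := fun s => by
    refine ((hD s).fun_mul (hI s).neg.exp).congr_deriv ?_
    simp only [Pi.neg_apply]
    ring
  have h1 := is_const_of_deriv_eq_zero (fun s => (hconst s).differentiableAt)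
    (fun s => (hconst s).deriv) t t₀
  simp only [I, intervalIntegral.integral_same, neg_zero, exp_zero, mul_one] at h1
  exact pos_of_mul_pos_left (h1 ▸ h) (exp_pos _).le

theorem antitone_of_hasDerivAt_neg {f g : ℝ → ℝ} (hf : ∀ t, HasDerivAt f (-g t) t)
    (hg : ∀ t, 0 ≤ g t) : Antitone f :=
  antitone_of_deriv_nonpos (fun t => (hf t).differentiableAt) fun t => by
    rw [(hf t).deriv]
    exact neg_nonpos.2 (hg t)

theorem lt_of_hasDerivAt_neg_of_tendsto_atBot {f g : ℝ → ℝ} {l : ℝ}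
    (hf : ∀ t, HasDerivAt f (-g t) t) (hg : ∀ t, 0 ≤ g t) (hg' : ∀ᶠ t in atBot, 0 < g t)
    (hl : Tendsto f atBot (𝓝 l)) (t : ℝ) : f t < l := by
  have hanti := antitone_of_hasDerivAt_neg hf hg
  obtain ⟨a, ha⟩ := eventually_atBot.1 hg'
  have hs : StrictAntiOn f (Iic a) := by
    refine strictAntiOn_of_deriv_neg (convex_Iic a)
      (fun s _ => (hf s).continuousAt.continuousWithinAt) fun s hs => ?_
    rw [interior_Iic] at hs
    rw [(hf s).deriv]
    exact neg_neg_of_pos (ha s hs.le)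
  have h1 : f t ≤ f (min t a) := hanti (min_le_left t a)
  have h2 : f (min t a) < f (min t a - 1) :=
    hs (show min t a - 1 ≤ a by linarith [min_le_right t a]) (min_le_right t a) (by linarith)
  exact (h1.trans_lt h2).trans_le (hanti.ge_of_tendsto hl _)

theorem not_tendsto_atTop_of_le_hasDerivAt {f f' : ℝ → ℝ} {k l : ℝ} (hk : 0 < k)
    (hf : ∀ t, HasDerivAt f (f' t) t) (hf' : ∀ᶠ t in atTop, k ≤ f' t) :
    ¬Tendsto f atTop (𝓝 l) := by
  obtain ⟨a, ha⟩ := eventually_atTop.1 hf'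
  have hmono : MonotoneOn (fun t => f t - k * t) (Ici a) := by
    have hd : ∀ t, HasDerivAt (fun t => f t - k * t) (f' t - k * 1) t := fun t =>
      (hf t).sub ((hasDerivAt_id t).const_mul k)
    refine monotoneOn_of_deriv_nonneg (convex_Ici a)
      (fun s _ => (hd s).continuousAt.continuousWithinAt)
      (fun s _ => (hd s).differentiableAt.differentiableWithinAt) fun s hs => ?_
    rw [interior_Ici] at hs
    rw [(hd s).deriv]
    linarith [ha s hs.le]
  refine not_tendsto_nhds_of_tendsto_atTop (tendsto_atTop_mono' atTop ?_
    (tendsto_atTop_add_const_left _ (f a - k * a) (tendsto_id.const_mul_atTop hk))) l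
  filter_upwards [eventually_ge_atTop a] with t ht
  have := hmono self_mem_Ici ht ht
  simp only [id] at this ⊢
  linarith

theorem MonotoneOn.exists_tendsto_atTop {f : ℝ → ℝ} {a B : ℝ} (hf : MonotoneOn f (Ici a))
    (hB : ∀ t, f t ≤ B) : ∃ l, Tendsto f atTop (𝓝 l) := by
  have hm : Monotone fun t => f (max t a) := fun s t hst =>
    hf (le_max_right s a) (le_max_right t a) (max_le_max_right a hst)
  refine ⟨_, (tendsto_atTop_ciSup hm ⟨B, ?_⟩).congr' ?_⟩
  · rintro _ ⟨t, rfl⟩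
    exact hB _
  · filter_upwards [eventually_ge_atTop a] with t ht
    rw [max_eq_left ht]

theorem eventually_pos_of_tendsto_exp_neg_mul {f : ℝ → ℝ} {l : ℝ} (hl : 0 < l)
    (hf : Tendsto (fun t => exp (-t) * f t) atBot (𝓝 l)) : ∀ᶠ t in atBot, 0 < f t := by
  filter_upwards [hf.eventually_const_lt hl] with t ht
  exact pos_of_mul_pos_right ht (exp_pos _).le

theorem tendsto_div_of_tendsto_exp_neg_mul {f g : ℝ → ℝ} {k l : ℝ} (hl : l ≠ 0)
    (hf : Tendsto (fun t => exp (-t) * f t) atBot (𝓝 k))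
    (hg : Tendsto (fun t => exp (-t) * g t) atBot (𝓝 l)) :
    Tendsto (fun t => f t / g t) atBot (𝓝 (k / l)) :=
  (hf.div hg hl).congr fun _ => mul_div_mul_left _ _ (exp_pos _).ne'

namespace IsRegularFlow

variable {α c : ℝ} {h V Z m ρ A : ℝ → ℝ}

theorem Z_pos (F : IsRegularFlow α c h V Z m ρ A) (t : ℝ) : 0 < Z t := by
  have hV : Continuous V := continuous_iff_continuousAt.2 fun t => (F.hasDerivAt_V t).continuousAt
  have hm : Continuous m := continuous_iff_continuousAt.2 fun t => (F.hasDerivAt_m t).continuousAt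
  obtain ⟨t₀, ht₀⟩ := (eventually_pos_of_tendsto_exp_neg_mul one_pos F.tendsto_Z).exists
  exact pos_of_hasDerivAt_mul (by fun_prop) F.hasDerivAt_Z ht₀ t

theorem ρ_pos (F : IsRegularFlow α c h V Z m ρ A) (t : ℝ) : 0 < ρ t := by
  have hm : Continuous m := continuous_iff_continuousAt.2 fun t => (F.hasDerivAt_m t).continuousAt
  obtain ⟨t₀, ht₀⟩ := (eventually_pos_of_tendsto_exp_neg_mul one_pos F.tendsto_ρ).exists
  exact pos_of_hasDerivAt_mul (by fun_prop) F.hasDerivAt_ρ ht₀ t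

theorem Z_lt_one (F : IsRegularFlow α c h V Z m ρ A) (t : ℝ) : Z t < 1 := by
  nlinarith [F.m_sq t, F.m_pos t, F.Z_pos t]

theorem A_bounds (F : IsRegularFlow α c h V Z m ρ A) (hα0 : 0 < α) (hα : α < 1 / 2) (t : ℝ) :
    0 < A t ∧ 1 - 2 * α ≤ A t ∧ 1 - 2 * α * sin (h t) ^ 2 ≤ A t := by
  have h1 := one_sub_two_mul_mul_sin_sq_pos hα0 hα (h t)
  have h2 := F.constraint t
  have h3 := F.V_sq_lt t
  have h4 : 0 < A t := pos_of_mul_pos_left (h2 ▸ h1.2) (by linarith)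
  have h5 : 0 ≤ A t * (α * V t ^ 2) := by positivity
  refine ⟨h4, ?_, ?_⟩ <;> linarith

theorem tendsto_A_atBot (F : IsRegularFlow α c h V Z m ρ A) : Tendsto A atBot (𝓝 1) := by
  have h1 := tendsto_zero_of_tendsto_exp_neg_mul F.tendsto_h
  have h2 := tendsto_zero_of_tendsto_exp_neg_mul F.tendsto_V
  have hc : Continuous fun x : ℝ => 1 - 2 * α * sin x ^ 2 := by fun_prop
  have h3 := (hc.tendsto 0).comp h1
  have h4 : Tendsto (fun t => 1 - α * V t ^ 2) atBot (𝓝 1) := by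
    simpa using ((h2.pow 2).const_mul α).const_sub 1
  have h5 := h3.div h4 one_ne_zero
  simp only [sin_zero, ne_eq, OfNat.ofNat_ne_zero, not_false_eq_true, zero_pow, mul_zero, sub_zero,
    div_one] at h5
  refine h5.congr fun t => ?_
  have := F.V_sq_lt t
  simp only [Pi.div_apply, Function.comp_apply]
  rw [← F.constraint, mul_div_cancel_right₀ _ (by linarith)]

theorem eventually_V_pos (F : IsRegularFlow α c h V Z m ρ A)
    (hc : 0 < c) : ∀ᶠ t in atBot, 0 < V t :=
  eventually_pos_of_tendsto_exp_neg_mul hc F.tendsto_V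

theorem A_lt_one (F : IsRegularFlow α c h V Z m ρ A)
    (hα0 : 0 < α) (hα : α < 1 / 2) (hc : 0 < c) (t : ℝ) : A t < 1 := by
  refine lt_of_hasDerivAt_neg_of_tendsto_atBot F.hasDerivAt_A (fun s => ?_) ?_ F.tendsto_A_atBot t
  · have := (F.A_bounds hα0 hα s).1
    positivity
  · filter_upwards [F.eventually_V_pos hc] with s hs
    have := (F.A_bounds hα0 hα s).1
    positivity

theorem antitone_A (F : IsRegularFlow α c h V Z m ρ A)
    (hα0 : 0 < α) (hα : α < 1 / 2) : Antitone A :=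
  antitone_of_hasDerivAt_neg F.hasDerivAt_A fun s => by
    have := (F.A_bounds hα0 hα s).1
    positivity

theorem div_antitone_and_lt_one (F : IsRegularFlow α c h V Z m ρ A) (hα0 : 0 < α) (hc : 0 < c) :
    Antitone (fun t => ρ t / Z t) ∧ ∀ t, ρ t / Z t < 1 := by
  have hd : ∀ t, HasDerivAt (fun t => ρ t / Z t) (-(ρ t / Z t * (α * V t ^ 2 * m t ^ 2))) t := by
    intro t
    have hZ := (F.Z_pos t).ne'
    refine ((F.hasDerivAt_ρ t).fun_div (F.hasDerivAt_Z t) hZ).congr_deriv ?_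
    field_simp
    ring
  have hnn : ∀ t, 0 ≤ ρ t / Z t * (α * V t ^ 2 * m t ^ 2) := fun t => by
    have := F.Z_pos t
    have := F.ρ_pos t
    positivity
  refine ⟨antitone_of_hasDerivAt_neg hd hnn,
    lt_of_hasDerivAt_neg_of_tendsto_atBot hd hnn ?_ ?_⟩
  · filter_upwards [F.eventually_V_pos hc] with t ht
    have := F.Z_pos t
    have := F.ρ_pos t
    have := F.m_pos t
    positivity
  · simpa using tendsto_div_of_tendsto_exp_neg_mul one_ne_zero F.tendsto_ρ F.tendsto_Z

theorem mul_div_sq_antitone_and_lt_one (F : IsRegularFlow α c h V Z m ρ A)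
    (hα0 : 0 < α) (hα : α < 1 / 2) (hc : 0 < c) :
    Antitone (fun t => A t * (Z t / ρ t) ^ 2) ∧ ∀ t, A t * (Z t / ρ t) ^ 2 < 1 := by
  have hd : ∀ t, HasDerivAt (fun t => A t * (Z t / ρ t) ^ 2)
      (-(2 * α * V t ^ 2 * Z t ^ 2 * (A t * (Z t / ρ t) ^ 2))) t := by
    intro t
    have hρ := (F.ρ_pos t).ne'
    refine ((F.hasDerivAt_A t).fun_mul
      (((F.hasDerivAt_Z t).fun_div (F.hasDerivAt_ρ t) hρ).fun_pow 2)).congr_deriv ?_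
    rw [F.m_sq]
    simp only [Nat.cast_ofNat, Nat.add_one_sub_one, pow_one]
    field_simp
    ring
  have hnn : ∀ t, 0 ≤ 2 * α * V t ^ 2 * Z t ^ 2 * (A t * (Z t / ρ t) ^ 2) := fun t => by
    have := (F.A_bounds hα0 hα t).1
    positivity
  refine ⟨antitone_of_hasDerivAt_neg hd hnn,
    lt_of_hasDerivAt_neg_of_tendsto_atBot hd hnn ?_ ?_⟩
  · filter_upwards [F.eventually_V_pos hc] with t ht
    have := F.Z_pos t
    have := F.ρ_pos t
    have := (F.A_bounds hα0 hα t).1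
    positivity
  · have := F.tendsto_A_atBot.mul
      ((tendsto_div_of_tendsto_exp_neg_mul one_ne_zero F.tendsto_Z F.tendsto_ρ).pow 2)
    simpa using this

theorem sin_h_ne_zero (F : IsRegularFlow α c h V Z m ρ A)
    (hα0 : 0 < α) (hα : α < 1 / 2) (hc : 0 < c) (t : ℝ) : sin (h t) ≠ 0 := by
  intro h0
  have h1 := (F.A_bounds hα0 hα t).2.2
  have h2 := F.A_lt_one hα0 hα hc t
  rw [h0] at h1
  norm_num at h1
  linarith

theorem h_mem_Ioo (F : IsRegularFlow α c h V Z m ρ A)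
    (hα0 : 0 < α) (hα : α < 1 / 2) (hc : 0 < c) (t : ℝ) : h t ∈ Ioo 0 π := by
  have hcont : Continuous h :=
    continuous_iff_continuousAt.2 fun t => (F.hasDerivAt_h t).continuousAt
  obtain ⟨t₀, h0, hπ⟩ := ((eventually_pos_of_tendsto_exp_neg_mul hc F.tendsto_h).and
    ((tendsto_zero_of_tendsto_exp_neg_mul F.tendsto_h).eventually_lt_const pi_pos)).exists
  constructor
  · by_contra! hle
    obtain ⟨s, hs⟩ := mem_range_of_exists_le_of_exists_ge hcont ⟨t, hle⟩ ⟨t₀, h0.le⟩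
    exact F.sin_h_ne_zero hα0 hα hc s (by rw [hs, sin_zero])
  · by_contra! hle
    obtain ⟨s, hs⟩ := mem_range_of_exists_le_of_exists_ge hcont ⟨t₀, hπ.le⟩ ⟨t, hle⟩
    exact F.sin_h_ne_zero hα0 hα hc s (by rw [hs, sin_pi])

theorem tendsto_Z_atTop (F : IsRegularFlow α c h V Z m ρ A)
    (hα0 : 0 < α) : Tendsto Z atTop (𝓝 1) := by
  have hmono : Monotone Z := by
    refine monotone_of_deriv_nonneg (fun t => (F.hasDerivAt_Z t).differentiableAt) fun t => ?_
    have := F.Z_pos t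
    rw [(F.hasDerivAt_Z t).deriv]
    positivity
  obtain ⟨l, hl⟩ := (hmono.monotoneOn (Ici 0)).exists_tendsto_atTop fun t => (F.Z_lt_one t).le
  have hle : ∀ t, Z t ≤ l := hmono.ge_of_tendsto hl
  have hl1 : l ≤ 1 := le_of_tendsto' hl fun t => (F.Z_lt_one t).le
  rcases hl1.eq_or_lt with rfl | hlt
  · exact hl
  have h0 := F.Z_pos 0
  have hl0 := hle 0
  refine absurd hl (not_tendsto_atTop_of_le_hasDerivAt (k := Z 0 * (1 - l ^ 2)) ?_
    F.hasDerivAt_Z ?_)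
  · exact mul_pos h0 (by nlinarith)
  · filter_upwards [eventually_ge_atTop 0] with t ht
    have h1 : Z 0 ≤ Z t := hmono ht
    have h2 := hle t
    have h3 : 1 - l ^ 2 ≤ m t ^ 2 := by rw [F.m_sq]; nlinarith
    have h4 : m t ^ 2 ≤ (1 + α * V t ^ 2) * m t ^ 2 :=
      le_mul_of_one_le_left (sq_nonneg _) (by nlinarith [mul_nonneg hα0.le (sq_nonneg (V t))])
    exact mul_le_mul h1 (h3.trans h4) (by nlinarith) (by linarith)

theorem strictMono_ρ (F : IsRegularFlow α c h V Z m ρ A) : StrictMono ρ := by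
  refine strictMono_of_deriv_pos fun t => ?_
  have := F.ρ_pos t
  have := F.m_pos t
  rw [(F.hasDerivAt_ρ t).deriv]
  positivity

theorem ρ_lt_Z (F : IsRegularFlow α c h V Z m ρ A) (hα0 : 0 < α) (hc : 0 < c) (t : ℝ) : ρ t < Z t :=
  (div_lt_one (F.Z_pos t)).1 ((F.div_antitone_and_lt_one hα0 hc).2 t)

theorem exists_tendsto_ρ_atTop (F : IsRegularFlow α c h V Z m ρ A)
    (hα0 : 0 < α) (hα : α < 1 / 2) (hc : 0 < c) :
    ∃ ρ₁, Tendsto ρ atTop (𝓝 ρ₁) ∧ √(1 - 2 * α) < ρ₁ ∧ ρ₁ < 1 ∧ ∀ t, ρ t < ρ₁ := by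
  obtain ⟨ρ₁, hρ₁⟩ := (F.strictMono_ρ.monotone.monotoneOn (Ici 0)).exists_tendsto_atTop
    fun t => ((F.ρ_lt_Z hα0 hc t).trans (F.Z_lt_one t)).le
  have hlt : ∀ t, ρ t < ρ₁ := fun t => (F.strictMono_ρ (lt_add_one t)).trans_le
    (F.strictMono_ρ.monotone.ge_of_tendsto hρ₁ _)
  have hZ := F.tendsto_Z_atTop hα0
  have hpos : 0 < ρ₁ := (F.ρ_pos 0).trans (hlt 0)
  refine ⟨ρ₁, hρ₁, ?_, ?_, hlt⟩
  · obtain ⟨h1, h2⟩ := F.mul_div_sq_antitone_and_lt_one hα0 hα hc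
    have h3 : 1 - 2 * α ≤ A 0 * (Z 0 / ρ 0) ^ 2 * ρ₁ ^ 2 := by
      have h4 := (hZ.pow 2).const_mul (1 - 2 * α)
      rw [one_pow, mul_one] at h4
      refine le_of_tendsto_of_tendsto h4 ((hρ₁.pow 2).const_mul (A 0 * (Z 0 / ρ 0) ^ 2)) ?_
      filter_upwards [eventually_ge_atTop 0] with t ht
      have h5 := mul_le_mul_of_nonneg_right (h1 ht) (sq_nonneg (ρ t))
      have h6 : A t * (Z t / ρ t) ^ 2 * ρ t ^ 2 = A t * Z t ^ 2 := by
        have := (F.ρ_pos t).ne'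
        field_simp
      have h7 := mul_le_mul_of_nonneg_right (F.A_bounds hα0 hα t).2.1 (sq_nonneg (Z t))
      simp only at h5
      linarith
    rw [sqrt_lt' hpos]
    exact h3.trans_lt (mul_lt_of_lt_one_left (by positivity) (h2 0))
  · obtain ⟨h1, h2⟩ := F.div_antitone_and_lt_one hα0 hc
    refine lt_of_le_of_lt ?_ (h2 0)
    have h3 := hZ.const_mul (ρ 0 / Z 0)
    rw [mul_one] at h3
    refine le_of_tendsto_of_tendsto hρ₁ h3 ?_
    filter_upwards [eventually_ge_atTop 0] with t ht
    exact (div_le_iff₀ (F.Z_pos t)).1 (h1 ht)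

theorem exists_tendsto_A_atTop (F : IsRegularFlow α c h V Z m ρ A) (hα0 : 0 < α) (hα : α < 1 / 2) :
    ∃ a, Tendsto A atTop (𝓝 a) :=
  ⟨_, tendsto_atTop_ciInf (F.antitone_A hα0 hα) ⟨0, by
    rintro _ ⟨t, rfl⟩
    exact (F.A_bounds hα0 hα t).1.le⟩⟩

theorem exists_tendsto_h_atTop (F : IsRegularFlow α c h V Z m ρ A)
    (hα0 : 0 < α) (hα : α < 1 / 2) (hc : 0 < c) :
    ∃ l, Tendsto h atTop (𝓝 l) := by
  have hρ0 := F.ρ_pos 0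
  have ha : 0 < 1 - 2 * α := by linarith
  have hd : ∀ t, HasDerivAt (fun t => h t - (4 * α * (1 - 2 * α))⁻¹ * A t + (2 * ρ 0)⁻¹ * ρ t)
      (V t * m t - (4 * α * (1 - 2 * α))⁻¹ * -(2 * α * A t * V t ^ 2)
        + (2 * ρ 0)⁻¹ * (ρ t * m t ^ 2)) t := fun t =>
    ((F.hasDerivAt_h t).sub ((F.hasDerivAt_A t).const_mul _)).add ((F.hasDerivAt_ρ t).const_mul _)
  have hmono : MonotoneOn
      (fun t => h t - (4 * α * (1 - 2 * α))⁻¹ * A t + (2 * ρ 0)⁻¹ * ρ t) (Ici 0) := by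
    refine monotoneOn_of_deriv_nonneg (convex_Ici 0)
      (fun s _ => (hd s).continuousAt.continuousWithinAt)
      (fun s _ => (hd s).differentiableAt.differentiableWithinAt) fun s hs => ?_
    rw [interior_Ici] at hs
    rw [(hd s).deriv]
    have h1 : 1 / 2 ≤ (4 * α * (1 - 2 * α))⁻¹ * (2 * α * A s) := by
      rw [inv_mul_eq_div, le_div_iff₀ (by positivity)]
      have := (F.A_bounds hα0 hα s).2.1
      nlinarith
    have h2 : 1 / 2 ≤ (2 * ρ 0)⁻¹ * ρ s := by
      rw [inv_mul_eq_div, le_div_iff₀ (by positivity)]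
      have := F.strictMono_ρ.monotone hs.le
      linarith
    have h3 := mul_le_mul_of_nonneg_right h1 (sq_nonneg (V s))
    have h4 := mul_le_mul_of_nonneg_right h2 (sq_nonneg (m s))
    nlinarith [sq_nonneg (V s + m s)]
  obtain ⟨ρ₁, hρ₁, -, -, hlt⟩ := F.exists_tendsto_ρ_atTop hα0 hα hc
  obtain ⟨b, hb⟩ := hmono.exists_tendsto_atTop (B := π + (2 * ρ 0)⁻¹ * ρ₁) fun t => by
    have h1 := (F.h_mem_Ioo hα0 hα hc t).2
    have h2 : 0 ≤ (4 * α * (1 - 2 * α))⁻¹ * A t :=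
      mul_nonneg (by positivity) (F.A_bounds hα0 hα t).1.le
    have h3 : (2 * ρ 0)⁻¹ * ρ t ≤ (2 * ρ 0)⁻¹ * ρ₁ :=
      mul_le_mul_of_nonneg_left (hlt t).le (by positivity)
    linarith
  obtain ⟨a, ha⟩ := F.exists_tendsto_A_atTop hα0 hα
  exact ⟨_, ((hb.add (ha.const_mul (4 * α * (1 - 2 * α))⁻¹)).sub
    (hρ₁.const_mul (2 * ρ 0)⁻¹)).congr fun t => by ring⟩

theorem exists_limits_atTop (F : IsRegularFlow α c h V Z m ρ A)
    (hα0 : 0 < α) (hα : α < 1 / 2) (hc : 0 < c) :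
    ∃ l ∈ Ioo 0 π, Tendsto h atTop (𝓝 l) ∧ Tendsto A atTop (𝓝 (1 - 2 * α * sin l ^ 2)) ∧
      Tendsto V atTop (𝓝 0) := by
  obtain ⟨l, hl⟩ := F.exists_tendsto_h_atTop hα0 hα hc
  obtain ⟨a, ha⟩ := F.exists_tendsto_A_atTop hα0 hα
  have ha0 : 0 < a := lt_of_lt_of_le (by linarith)
    (ge_of_tendsto' ha fun t => (F.A_bounds hα0 hα t).2.1)
  have ha1 : a < 1 := ((F.antitone_A hα0 hα).le_of_tendsto ha 0).trans_lt
    (F.A_lt_one hα0 hα hc 0)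
  have hsin : Tendsto (fun t => 1 - 2 * α * sin (h t) ^ 2) atTop (𝓝 (1 - 2 * α * sin l ^ 2)) := by
    have hcont : Continuous fun x : ℝ => 1 - 2 * α * sin x ^ 2 := by fun_prop
    exact (hcont.tendsto l).comp hl
  have hV2 : Tendsto (fun t => α * V t ^ 2) atTop (𝓝 (1 - (1 - 2 * α * sin l ^ 2) / a)) := by
    refine ((hsin.div ha ha0.ne').const_sub 1).congr fun t => ?_
    simp only [Pi.div_apply]
    rw [← F.constraint, mul_div_cancel_left₀ _ (F.A_bounds hα0 hα t).1.ne']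
    ring
  have hlim : 1 - (1 - 2 * α * sin l ^ 2) / a = 0 := by
    set w := 1 - (1 - 2 * α * sin l ^ 2) / a
    have hw : 0 ≤ w := ge_of_tendsto' hV2 fun t => by positivity
    by_contra hne
    have hwpos : 0 < w := lt_of_le_of_ne hw (Ne.symm hne)
    refine not_tendsto_atTop_of_le_hasDerivAt (f := fun t => -A t) (k := (1 - 2 * α) * w)
      (mul_pos (by linarith) hwpos) (fun t => (F.hasDerivAt_A t).neg) ?_ ha.neg
    filter_upwards [hV2.eventually_const_lt (half_lt_self hwpos)] with t ht
    have h1 := (F.A_bounds hα0 hα t).2.1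
    rw [neg_neg]
    nlinarith
  rw [hlim] at hV2
  have ha' : a = 1 - 2 * α * sin l ^ 2 := by
    rw [sub_eq_zero, eq_div_iff ha0.ne', one_mul] at hlim
    exact hlim
  have hs : sin l ≠ 0 := by
    intro h0
    rw [h0] at ha'
    norm_num at ha'
    linarith
  refine ⟨l, ⟨?_, ?_⟩, hl, ha' ▸ ha, ?_⟩
  · refine lt_of_le_of_ne (ge_of_tendsto' hl fun t => (F.h_mem_Ioo hα0 hα hc t).1.le) ?_
    rintro rfl
    exact hs sin_zero
  · refine lt_of_le_of_ne (le_of_tendsto' hl fun t => (F.h_mem_Ioo hα0 hα hc t).2.le) ?_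
    rintro rfl
    exact hs sin_pi
  · have h1 := (hV2.const_mul α⁻¹).sqrt
    rw [mul_zero, sqrt_zero] at h1
    refine (tendsto_zero_iff_abs_tendsto_zero _).2 (h1.congr fun t => ?_)
    rw [inv_mul_cancel_left₀ hα0.ne', sqrt_sq_eq_abs]
    rfl

end IsRegularFlow

theorem StrictMono.exists_inverse_hasDerivAt {ρ r : ℝ → ℝ} {ρ₀ ρ₁ : ℝ} (hρ : StrictMono ρ)
    (hd : ∀ t, HasDerivAt ρ (r t) t) (hr : ∀ t, r t ≠ 0) (h0 : Tendsto ρ atBot (𝓝 ρ₀))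
    (h1 : Tendsto ρ atTop (𝓝 ρ₁)) :
    ∃ σ : ℝ → ℝ, (∀ x ∈ Ioo ρ₀ ρ₁, ρ (σ x) = x ∧ HasDerivAt σ (r (σ x))⁻¹ x) ∧
      Tendsto σ (𝓝[>] ρ₀) atBot ∧ Tendsto σ (𝓝[<] ρ₁) atTop := by
  have hcont : Continuous ρ := continuous_iff_continuousAt.2 fun t => (hd t).continuousAt
  have hlo : ∀ t, ρ₀ < ρ t := fun t =>
    (hρ.monotone.le_of_tendsto h0 _).trans_lt (hρ (sub_one_lt t))
  have hhi : ∀ t, ρ t < ρ₁ := fun t =>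
    (hρ (lt_add_one t)).trans_le (hρ.monotone.ge_of_tendsto h1 _)
  have hσl : ∀ t, Function.invFun ρ (ρ t) = t := Function.leftInverse_invFun hρ.injective
  have hσr : ∀ x ∈ Ioo ρ₀ ρ₁, ρ (Function.invFun ρ x) = x := by
    intro x hx
    obtain ⟨a, ha⟩ := (h0.eventually_lt_const hx.1).exists
    obtain ⟨b, hb⟩ := (h1.eventually_const_lt hx.2).exists
    exact Function.invFun_eq (mem_range_of_exists_le_of_exists_ge hcont ⟨a, ha.le⟩ ⟨b, hb.le⟩)
  have hmono : StrictMonoOn (Function.invFun ρ) (Ioo ρ₀ ρ₁) := fun x hx y hy hxy => by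
    rw [← hρ.lt_iff_lt, hσr x hx, hσr y hy]
    exact hxy
  have himage : Function.invFun ρ '' Ioo ρ₀ ρ₁ = univ :=
    eq_univ_of_forall fun t => ⟨ρ t, ⟨hlo t, hhi t⟩, hσl t⟩
  have hlt : ρ₀ < ρ₁ := (hlo 0).trans (hhi 0)
  refine ⟨Function.invFun ρ, fun x hx => ⟨hσr x hx, ?_⟩, ?_, ?_⟩
  · have hx' : Ioo ρ₀ ρ₁ ∈ 𝓝 x := Ioo_mem_nhds hx.1 hx.2
    exact (hd _).of_local_left_inverse
      (hmono.continuousAt_of_image_mem_nhds hx' (by rw [himage]; exact univ_mem)) (hr _)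
      (by filter_upwards [hx'] with y hy using hσr y hy)
  · refine Filter.tendsto_atBot.2 fun M => ?_
    filter_upwards [Ioo_mem_nhdsGT (hlo M)] with x hx
    rw [← hρ.le_iff_le, hσr x ⟨hx.1, hx.2.trans (hhi M)⟩]
    exact hx.2.le
  · refine Filter.tendsto_atTop.2 fun M => ?_
    filter_upwards [Ioo_mem_nhdsLT (hhi M)] with x hx
    rw [← hρ.le_iff_le, hσr x ⟨(hlo M).trans hx.1, hx.2⟩]
    exact hx.1.le

theorem IsRegularFlow.isCOrbit {α c : ℝ} {h V Z m ρ A σ : ℝ → ℝ} {ρ₁ : ℝ}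
    (F : IsRegularFlow α c h V Z m ρ A) (hα0 : 0 < α) (hα : α < 1 / 2) (hρ₁ : 0 < ρ₁)
    (hσ : ∀ x ∈ Ioo 0 ρ₁, ρ (σ x) = x ∧ HasDerivAt σ (ρ (σ x) * m (σ x) ^ 2)⁻¹ x)
    (hσ0 : Tendsto σ (𝓝[>] 0) atBot) :
    IsCOrbit α c (fun x => if 0 < x then h (σ x) - π / 2 else -(π / 2))
      (fun x => V (σ x) / (m (σ x) * x)) (fun x => if 0 < x then A (σ x) else 1)
      (fun x => if 0 < x then Z (σ x) else 0) ρ₁ := by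
  have hev : ∀ x ∈ Ioo 0 ρ₁, ∀ (f : ℝ → ℝ) (a : ℝ),
      (fun x => if 0 < x then f x else a) =ᶠ[𝓝 x] f := fun x hx f a => by
    filter_upwards [lt_mem_nhds hx.1] with y hy using if_pos hy
  have hev0 : ∀ (f : ℝ → ℝ) (a : ℝ), f =ᶠ[𝓝[>] 0] (fun x => if 0 < x then f x else a) :=
    fun f a => by filter_upwards [self_mem_nhdsWithin] with y hy using (if_pos hy).symm
  have hm : ∀ t, m t ≠ 0 := fun t => (F.m_pos t).ne'
  have hA : ∀ t, A t ≠ 0 := fun t => (F.A_bounds hα0 hα t).1.ne'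
  have hpos : ∀ᶠ x in 𝓝[>] (0 : ℝ), x ∈ Ioo 0 ρ₁ := Ioo_mem_nhdsGT hρ₁
  have hm0 : Tendsto m atBot (𝓝 1) := by
    have h1 := (((tendsto_zero_of_tendsto_exp_neg_mul F.tendsto_Z).pow 2).const_sub 1).sqrt
    norm_num at h1
    refine h1.congr fun t => ?_
    rw [← F.m_sq, sqrt_sq (F.m_pos t).le]
  constructor
  · exact hρ₁
  · intro x hx
    obtain ⟨hx', hd⟩ := hσ x hx
    refine HasDerivAt.congr_of_eventuallyEq ?_ (hev x hx _ _)
    refine (((F.hasDerivAt_h _).comp x hd).sub_const (π / 2)).congr_deriv ?_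
    have := hm (σ x)
    have := hx.1.ne'
    rw [hx']
    field_simp
  · intro x hx
    obtain ⟨hx', hd⟩ := hσ x hx
    have h1 := hm (σ x)
    have h2 := hx.1.ne'
    have h3 := hA (σ x)
    refine (((F.hasDerivAt_V _).comp x hd).fun_div
      (((F.hasDerivAt_m _).comp x hd).fun_mul (hasDerivAt_id x)) (mul_ne_zero h1 h2)).congr_deriv ?_
    simp only [if_pos hx.1, Function.comp_apply, id]
    have h4 : sin (2 * (h (σ x) - π / 2)) = -sin (2 * h (σ x)) := by
      rw [mul_sub, mul_div_cancel₀ _ two_ne_zero, sin_sub_pi]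
    have h5 : 1 - α * V (σ x) ^ 2 ≠ 0 := by linarith [F.V_sq_lt (σ x)]
    have h6 : Z (σ x) ^ 2 = 1 - m (σ x) ^ 2 := by linarith [F.m_sq (σ x)]
    rw [h4, hx', ← F.constraint, ← F.m_sq, h6]
    generalize sin (2 * h (σ x)) = s
    field_simp
    ring
  · intro x hx
    obtain ⟨hx', hd⟩ := hσ x hx
    refine HasDerivAt.congr_of_eventuallyEq ?_ (hev x hx _ _)
    refine ((F.hasDerivAt_A _).comp x hd).congr_deriv ?_
    have := hm (σ x)
    have := hx.1.ne'
    simp only [if_pos hx.1]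
    rw [hx']
    field_simp
  · intro x hx
    obtain ⟨hx', hd⟩ := hσ x hx
    refine HasDerivAt.congr_of_eventuallyEq ?_ (hev x hx _ _)
    refine ((F.hasDerivAt_Z _).comp x hd).congr_deriv ?_
    have := hm (σ x)
    have := hx.1.ne'
    simp only [if_pos hx.1]
    rw [hx', ← F.m_sq]
    field_simp
  · intro x hx
    have h1 := hm (σ x)
    have h2 := hx.1.ne'
    simp only [if_pos hx.1]
    have h3 : sin (h (σ x) - π / 2) ^ 2 = 1 - sin (h (σ x)) ^ 2 := by
      rw [sin_sub_pi_div_two, neg_sq, cos_sq']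
    rw [h3, ← F.m_sq]
    have h4 := F.constraint (σ x)
    field_simp
    linarith
  · intro x hx
    simp only [if_pos hx.1]
    exact (F.A_bounds hα0 hα _).1
  · intro x hx
    simp only [if_pos hx.1]
    exact ⟨(F.Z_pos _).le, F.Z_lt_one _⟩
  · simp
  · simp
  · simp
  · refine Tendsto.congr' (hev0 _ _) ?_
    have := (tendsto_zero_of_tendsto_exp_neg_mul F.tendsto_h).sub_const (π / 2)
    rw [zero_sub] at this
    exact this.comp hσ0
  · have h1 := (tendsto_div_of_tendsto_exp_neg_mul one_ne_zero F.tendsto_V F.tendsto_ρ).div hm0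
      one_ne_zero
    rw [div_one, div_one] at h1
    refine (h1.comp hσ0).congr' ?_
    filter_upwards [hpos] with x hx
    simp only [Function.comp_apply, Pi.div_apply]
    rw [(hσ x hx).1, div_div, mul_comm x]
  · exact (F.tendsto_A_atBot.comp hσ0).congr' (hev0 _ _)
  · exact ((tendsto_zero_of_tendsto_exp_neg_mul F.tendsto_Z).comp hσ0).congr' (hev0 _ _)
  · have h1 := tendsto_div_of_tendsto_exp_neg_mul one_ne_zero F.tendsto_Z F.tendsto_ρ
    rw [div_one] at h1
    refine (h1.comp hσ0).congr' ?_
    filter_upwards [hpos] with x hx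
    simp only [Function.comp_apply]
    rw [(hσ x hx).1, if_pos hx.1]

/-- Proposition 2: for every `α ∈ (0,1/2)` and `c > 0` there is a `c`-orbit
defined on `(0, ρ₁(c))` with `ρ₁(c) ∈ (√(1-2α), 1)`, with `Z → 1` at `ρ₁(c)`;
moreover `H` and `A` have limits `H̄ ∈ (-π/2, π/2)` and `Ā = 1 - 2α cos²H̄`
at `ρ₁(c)`, and `(1 - Z²) H'² → 0` there. -/
theorem proposition2 (α : ℝ) (hα0 : 0 < α) (hα : α < 1 / 2)
    (c : ℝ) (hc : 0 < c) :
    ∃ (H H' A Z : ℝ → ℝ) (ρ₁ : ℝ),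
      IsCOrbit α c H H' A Z ρ₁ ∧
      Real.sqrt (1 - 2 * α) < ρ₁ ∧ ρ₁ < 1 ∧
      Tendsto Z (𝓝[<] ρ₁) (𝓝 1) ∧
      ∃ Hbar : ℝ, -(π / 2) < Hbar ∧ Hbar < π / 2 ∧
        Tendsto H (𝓝[<] ρ₁) (𝓝 Hbar) ∧
        Tendsto A (𝓝[<] ρ₁) (𝓝 (1 - 2 * α * Real.cos Hbar ^ 2)) ∧
        Tendsto (fun ρ => (1 - Z ρ ^ 2) * H' ρ ^ 2) (𝓝[<] ρ₁) (𝓝 0) := by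
  obtain ⟨h, V, Z, m, ρ, A, F⟩ := exists_isRegularFlow hα0 hα c
  obtain ⟨ρ₁, hρ₁, hlow, hup, -⟩ := F.exists_tendsto_ρ_atTop hα0 hα hc
  have hpos : 0 < ρ₁ := (sqrt_nonneg _).trans_lt hlow
  obtain ⟨σ, hσ, hσ0, hσ1⟩ := F.strictMono_ρ.exists_inverse_hasDerivAt F.hasDerivAt_ρ
    (fun t => (mul_pos (F.ρ_pos t) (pow_pos (F.m_pos t) 2)).ne')
    (tendsto_zero_of_tendsto_exp_neg_mul F.tendsto_ρ) hρ₁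
  obtain ⟨l, ⟨hl0, hlπ⟩, hl, hA, hV⟩ := F.exists_limits_atTop hα0 hα hc
  have hev : ∀ (f : ℝ → ℝ) (a : ℝ), f =ᶠ[𝓝[<] ρ₁] (fun x => if 0 < x then f x else a) :=
    fun f a => by filter_upwards [Ioo_mem_nhdsLT hpos] with y hy using (if_pos hy.1).symm
  refine ⟨_, _, _, _, ρ₁, F.isCOrbit hα0 hα hpos hσ hσ0, hlow, hup,
    ((F.tendsto_Z_atTop hα0).comp hσ1).congr' (hev _ _), l - π / 2, by linarith, by linarith,
    ((hl.sub_const (π / 2)).comp hσ1).congr' (hev _ _), ?_, ?_⟩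
  · rw [cos_sub_pi_div_two]
    exact (hA.comp hσ1).congr' (hev _ _)
  · have h1 := (hV.div hρ₁ hpos.ne').pow 2
    rw [zero_div, zero_pow two_ne_zero] at h1
    refine (h1.comp hσ1).congr' ?_
    filter_upwards [Ioo_mem_nhdsLT hpos] with x hx
    have h2 := (F.m_pos (σ x)).ne'
    have h3 := hx.1.ne'
    simp only [Function.comp_apply, Pi.div_apply, if_pos hx.1]
    rw [(hσ x hx).1, ← F.m_sq]
    field_simp
end
end

section
/- The function c ↦ ρ₁(c) is continuous on (0, ∞): for every c̃ > 0 and every ε > 0 there exists δ > 0 such that |ρ₁(c) − ρ₁(c̃)| < ε whenever c > 0 and |c − c̃| < δ. -/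
open Real Filter Set Topology Asymptotics MeasureTheory

noncomputable section

/-- Near a critical point, a `C²` function has Lipschitz constant proportional to the radius. -/
theorem exists_norm_sub_le_mul_radius {E : Type*} [NormedAddCommGroup E] [NormedSpace ℝ E]
    {f : E → ℝ} {U K : Set E} (hU : IsOpen U) (hf : ContDiffOn ℝ 2 f U) (hKU : K ⊆ U)
    (hK : IsCompact K) (hKc : Convex ℝ K) (h0 : (0 : E) ∈ K) (hf0 : fderiv ℝ f 0 = 0) :
    ∃ C, 0 ≤ C ∧ ∀ x ∈ K, ∀ y ∈ K, ∀ r, ‖x‖ ≤ r → ‖y‖ ≤ r → |f x - f y| ≤ C * r * ‖x - y‖ := by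
  have hf1 : ContDiffOn ℝ 1 (fderiv ℝ f) U := hf.fderiv_of_isOpen hU (by norm_num)
  have hf2 : ContinuousOn (fderiv ℝ (fderiv ℝ f)) U :=
    hf1.continuousOn_fderiv_of_isOpen hU (by norm_num)
  obtain ⟨C, hC⟩ := hK.exists_bound_of_continuousOn (f := fderiv ℝ (fderiv ℝ f)) (hf2.mono hKU)
  have hC0 : 0 ≤ C := (norm_nonneg _).trans (hC 0 h0)
  have key : ∀ x ∈ K, ‖fderiv ℝ f x‖ ≤ C * ‖x‖ := by
    intro x hx
    have := hKc.norm_image_sub_le_of_norm_fderiv_le (𝕜 := ℝ) (f := fderiv ℝ f) (C := C)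
      (fun y hy => (hf1.differentiableOn (by norm_num)).differentiableAt
        (hU.mem_nhds (hKU hy))) hC h0 hx
    simpa [hf0] using this
  refine ⟨C, hC0, fun x hx y hy r hxr hyr => ?_⟩
  have hconv : Convex ℝ (K ∩ Metric.closedBall 0 r) := hKc.inter (convex_closedBall _ _)
  have := hconv.norm_image_sub_le_of_norm_fderiv_le (𝕜 := ℝ) (f := f) (C := C * r)
      (fun z hz => (hf.differentiableOn (by norm_num)).differentiableAt
        (hU.mem_nhds (hKU hz.1)))
      (fun z hz => (key z hz.1).trans
        (mul_le_mul_of_nonneg_left (by simpa using hz.2) hC0))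
      (x := y) (y := x) ⟨hy, by simpa using hyr⟩ ⟨hx, by simpa using hxr⟩
  simpa [Real.norm_eq_abs] using this

/-- A Grönwall bootstrap started from a limit at the left end `0`: the differential inequality is
needed only where `E < η`. -/
theorem lt_of_deriv_le_of_tendsto_zero {E E' : ℝ → ℝ} {m C E₀ η : ℝ} (hC : 0 ≤ C) (hE₀ : 0 ≤ E₀)
    (hE : ∀ x ∈ Ioo 0 m, HasDerivAt E (E' x) x) (hlim : Tendsto E (𝓝[>] 0) (𝓝 E₀))
    (hbd : ∀ x ∈ Ioo 0 m, E x < η → E' x ≤ C * E x) (hη : E₀ * exp ((C + 1) * m) < η) :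
    ∀ x ∈ Ioo 0 m, E x < η := by
  intro x hx
  have hcont : Tendsto (fun e : ℝ => (E₀ + e) * exp ((C + 1) * m)) (𝓝[>] 0)
      (𝓝 ((E₀ + 0) * exp ((C + 1) * m))) :=
    (Continuous.tendsto (by fun_prop) 0).mono_left nhdsWithin_le_nhds
  rw [add_zero] at hcont
  obtain ⟨e, he, he0⟩ := ((hcont.eventually_lt_const hη).and self_mem_nhdsWithin).exists
  replace he0 : 0 < e := he0
  obtain ⟨a, ⟨haE, ha0⟩, hax⟩ := (((hlim.eventually_lt_const (by linarith : E₀ < E₀ + e)).and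
    self_mem_nhdsWithin).and (mem_nhdsWithin_of_mem_nhds (Iio_mem_nhds hx.1))).exists
  replace ha0 : 0 < a := ha0
  replace hax : a < x := hax
  have hB : ∀ y, HasDerivAt (fun y => (E₀ + e) * exp ((C + 1) * y))
      ((C + 1) * ((E₀ + e) * exp ((C + 1) * y))) y := by
    intro y
    have := (((hasDerivAt_id y).const_mul (C + 1)).exp).const_mul (E₀ + e)
    exact this.congr_deriv (by simp; ring)
  have hBlt : ∀ y ∈ Icc a x, (E₀ + e) * exp ((C + 1) * y) < η := by
    intro y hy
    refine lt_of_le_of_lt ?_ he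
    have : y ≤ m := hy.2.trans hx.2.le
    gcongr
  have hsub : ∀ y ∈ Icc a x, y ∈ Ioo 0 m := fun y hy =>
    ⟨ha0.trans_le hy.1, hy.2.trans_lt hx.2⟩
  have := image_le_of_deriv_right_lt_deriv_boundary' (f := E) (f' := E') (a := a) (b := x)
    (fun y hy => (hE y (hsub y hy)).continuousAt.continuousWithinAt)
    (fun y hy => (hE y (hsub y ⟨hy.1, hy.2.le⟩)).hasDerivWithinAt)
    (B := fun y => (E₀ + e) * exp ((C + 1) * y))
    (B' := fun y => (C + 1) * ((E₀ + e) * exp ((C + 1) * y)))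
    (by
      have h1 : 1 ≤ exp ((C + 1) * a) := one_le_exp (by positivity)
      nlinarith)
    (fun y _ => (hB y).continuousAt.continuousWithinAt)
    (fun y _ => (hB y).hasDerivWithinAt)
    (by
      intro y hy hyE
      have hy' : y ∈ Icc a x := ⟨hy.1, hy.2.le⟩
      have h1 := hbd y (hsub y hy') (by rw [hyE]; exact hBlt y hy')
      have h2 : 0 < (E₀ + e) * exp ((C + 1) * y) := by positivity
      rw [hyE] at h1
      linarith)
    (right_mem_Icc.2 hax.le)
  exact this.trans_lt (hBlt x (right_mem_Icc.2 hax.le))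

/-- A function continuous on `(0, b]` with a limit at `0` is bounded there. -/
theorem exists_abs_le_of_tendsto_zero {f : ℝ → ℝ} {b l : ℝ} (hf : ContinuousOn f (Ioc 0 b))
    (hlim : Tendsto f (𝓝[>] 0) (𝓝 l)) : ∃ B, ∀ x ∈ Ioc 0 b, |f x| ≤ B := by
  obtain ⟨a, ha0, ha⟩ := mem_nhdsGT_iff_exists_Ioc_subset.1
    (hlim.abs.eventually_lt_const (lt_add_one |l|))
  simp only [mem_Ioi] at ha0
  obtain ⟨B, hB⟩ := (isCompact_Icc (a := a) (b := b)).exists_bound_of_continuousOn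
    (hf.mono fun x hx => ⟨ha0.trans_le hx.1, hx.2⟩)
  refine ⟨max (|l| + 1) B, fun x hx => ?_⟩
  rcases le_total x a with h | h
  · have h1 : |f x| < |l| + 1 := ha ⟨hx.1, h⟩
    exact h1.le.trans (le_max_left _ _)
  · exact (hB x ⟨h, hx.2⟩).trans (le_max_right _ _)

/-- The part of `ρ² H″` vanishing to second order at the origin, as a function of
`(h, u, Z) = (H + π/2, ρH', Z)`, with `A` eliminated through the constraint. -/
def cssForce (α : ℝ) (X : ℝ × ℝ × ℝ) : ℝ :=
  α * (1 + X.2.2 ^ 2) * X.2.1 ^ 3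
    + sin (2 * X.1) * (1 / (1 - X.2.2 ^ 2) - α * X.2.1 ^ 2) / (1 - 2 * α * sin X.1 ^ 2) - 2 * X.1

/-- The function `ρ² (Z/ρ)'` of `(h, u, Z) = (H + π/2, ρH', Z)`. -/
def cssStretch (α : ℝ) (X : ℝ × ℝ × ℝ) : ℝ :=
  α * X.2.2 * (1 - X.2.2 ^ 2) * X.2.1 ^ 2

theorem one_sub_mul_sin_sq_pos {α : ℝ} (hα0 : 0 < α) (hα : α < 1 / 2) (h : ℝ) :
    0 < 1 - 2 * α * sin h ^ 2 := by
  nlinarith [sin_sq_le_one h, sq_nonneg (sin h)]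

theorem contDiffOn_cssForce {α : ℝ} (hα0 : 0 < α) (hα : α < 1 / 2) :
    ContDiffOn ℝ 2 (cssForce α) {X | |X.2.2| < 1} := by
  intro X hX
  apply ContDiffAt.contDiffWithinAt
  have h1 : 1 - X.2.2 ^ 2 ≠ 0 := by
    have := (sq_lt_one_iff_abs_lt_one X.2.2).2 hX
    linarith
  have h2 : 1 - 2 * α * sin X.1 ^ 2 ≠ 0 := (one_sub_mul_sin_sq_pos hα0 hα _).ne'
  unfold cssForce
  fun_prop (disch := assumption)

theorem contDiff_cssStretch (α : ℝ) : ContDiff ℝ 2 (cssStretch α) := by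
  unfold cssStretch
  fun_prop

/-- A derivative at `0` vanishes once all derivatives along rays do. -/
theorem fderiv_zero_eq_zero_of_hasDerivAt {E : Type*} [NormedAddCommGroup E] [NormedSpace ℝ E]
    {f : E → ℝ} (hf : DifferentiableAt ℝ f 0)
    (h : ∀ v : E, HasDerivAt (fun t : ℝ => f (t • v)) 0 0) : fderiv ℝ f 0 = 0 := by
  ext v
  have h1 : HasDerivAt (fun t : ℝ => t • v) v 0 := by
    simpa using (hasDerivAt_id (0 : ℝ)).smul_const v
  have h2 : HasFDerivAt f (fderiv ℝ f 0) ((0 : ℝ) • v) := by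
    simpa using hf.hasFDerivAt
  exact (h2.comp_hasDerivAt (0 : ℝ) h1).unique (h v)

theorem fderiv_cssForce_zero {α : ℝ} (hα0 : 0 < α) (hα : α < 1 / 2) :
    fderiv ℝ (cssForce α) 0 = 0 := by
  have hopen : IsOpen {X : ℝ × ℝ × ℝ | |X.2.2| < 1} :=
    isOpen_lt (by fun_prop) continuous_const
  refine fderiv_zero_eq_zero_of_hasDerivAt (((contDiffOn_cssForce hα0 hα).differentiableOn
    (by norm_num)).differentiableAt (hopen.mem_nhds (by simp))) ?_
  rintro ⟨a, b, c⟩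
  simp only [cssForce, Prod.smul_mk, smul_eq_mul]
  have hl : ∀ a : ℝ, HasDerivAt (fun t : ℝ => t * a) a 0 := fun a => by
    simpa using (hasDerivAt_id (0 : ℝ)).mul_const a
  have h1 := ((((hl c).fun_pow 2).const_add 1).const_mul α).fun_mul ((hl b).fun_pow 3)
  have h2 := (((hl c).fun_pow 2).const_sub 1).fun_inv (by simp)
  have h3 := h2.fun_sub (((hl b).fun_pow 2).const_mul α)
  have h4 := ((((hl a).const_mul 2).sin).fun_mul h3).fun_div
    ((((hl a).sin.fun_pow 2).const_mul (2 * α)).const_sub 1) (by simp)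
  have h5 := (h1.fun_add h4).fun_sub ((hl a).const_mul 2)
  simp only [one_div]
  exact h5.congr_deriv (by simp)

theorem fderiv_cssStretch_zero (α : ℝ) : fderiv ℝ (cssStretch α) 0 = 0 := by
  refine fderiv_zero_eq_zero_of_hasDerivAt
    ((contDiff_cssStretch α).differentiable (by norm_num)).differentiableAt ?_
  rintro ⟨a, b, c⟩
  simp only [cssStretch, Prod.smul_mk, smul_eq_mul]
  have hl : ∀ a : ℝ, HasDerivAt (fun t : ℝ => t * a) a 0 := fun a => by
    simpa using (hasDerivAt_id (0 : ℝ)).mul_const a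
  have h1 := (((hl c).const_mul α).fun_mul (((hl c).fun_pow 2).const_sub 1)).fun_mul
    ((hl b).fun_pow 2)
  exact h1.congr_deriv (by simp)

/-- Uniform Lipschitz bounds for the nonlinear terms, with constants linear in the radius. -/
theorem exists_css_lipschitz {α : ℝ} (hα0 : 0 < α) (hα : α < 1 / 2) {R q : ℝ} (hR : 0 ≤ R)
    (hq0 : 0 ≤ q) (hq : q < 1) :
    ∃ C, 0 ≤ C ∧ ∀ X Y : ℝ × ℝ × ℝ, |X.1| ≤ R → |X.2.1| ≤ R → |X.2.2| ≤ q →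
      |Y.1| ≤ R → |Y.2.1| ≤ R → |Y.2.2| ≤ q → ∀ r, ‖X‖ ≤ r → ‖Y‖ ≤ r →
      |cssForce α X - cssForce α Y| ≤ C * r * ‖X - Y‖ ∧
      |cssStretch α X - cssStretch α Y| ≤ C * r * ‖X - Y‖ := by
  have hopen : IsOpen {X : ℝ × ℝ × ℝ | |X.2.2| < 1} :=
    isOpen_lt (by fun_prop) continuous_const
  set K : Set (ℝ × ℝ × ℝ) := Metric.closedBall 0 R ×ˢ Metric.closedBall 0 R ×ˢ
    Metric.closedBall 0 q with hKdef
  have hmem : ∀ X : ℝ × ℝ × ℝ, |X.1| ≤ R → |X.2.1| ≤ R → |X.2.2| ≤ q → X ∈ K := by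
    intro X h1 h2 h3
    simp [hKdef, mem_prod, h1, h2, h3]
  have hK : IsCompact K := (isCompact_closedBall _ _).prod
    ((isCompact_closedBall _ _).prod (isCompact_closedBall _ _))
  have hKc : Convex ℝ K := (convex_closedBall _ _).prod
    ((convex_closedBall _ _).prod (convex_closedBall _ _))
  have h0 : (0 : ℝ × ℝ × ℝ) ∈ K := hmem 0 (by simpa) (by simpa) (by simpa)
  have hKU : K ⊆ {X | |X.2.2| < 1} := by
    intro X hX
    have : |X.2.2| ≤ q := by simpa using hX.2.2
    exact this.trans_lt hq
  obtain ⟨C₁, hC₁, h1⟩ := exists_norm_sub_le_mul_radius hopen (contDiffOn_cssForce hα0 hα) hKU hK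
    hKc h0 (fderiv_cssForce_zero hα0 hα)
  obtain ⟨C₂, hC₂, h2⟩ := exists_norm_sub_le_mul_radius isOpen_univ
    (contDiff_cssStretch α).contDiffOn (subset_univ K) hK hKc h0 (fderiv_cssStretch_zero α)
  refine ⟨max C₁ C₂, hC₁.trans (le_max_left _ _),
    fun X Y hX1 hX2 hX3 hY1 hY2 hY3 r hXr hYr => ?_⟩
  have hr : 0 ≤ r := (norm_nonneg X).trans hXr
  constructor
  · refine (h1 X (hmem X hX1 hX2 hX3) Y (hmem Y hY1 hY2 hY3) r hXr hYr).trans ?_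
    gcongr
    exact le_max_left _ _
  · refine (h2 X (hmem X hX1 hX2 hX3) Y (hmem Y hY1 hY2 hY3) r hXr hYr).trans ?_
    gcongr
    exact le_max_right _ _

namespace IsCOrbit

variable {α c : ℝ} {H H' A Z : ℝ → ℝ} {ρ₁ : ℝ}

theorem tendsto_slope (h : IsCOrbit α c H H' A Z ρ₁) :
    Tendsto (fun ρ => (H ρ + π / 2) / ρ) (𝓝[>] 0) (𝓝 c) := by
  have hderiv : HasDerivWithinAt H c (Ici 0) 0 := by
    refine hasDerivWithinAt_Ici_of_tendsto_deriv (s := Ioo 0 ρ₁)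
      (fun x hx => (h.hH x hx).differentiableAt.differentiableWithinAt) ?_
      (Ioo_mem_nhdsGT h.rho1_pos) ?_
    · have := h.Hcont
      rw [← h.H0] at this
      exact this.mono_left (nhdsWithin_mono _ Ioo_subset_Ioi_self)
    · refine h.H'init.congr' ?_
      filter_upwards [Ioo_mem_nhdsGT h.rho1_pos] with x hx
      exact (h.hH x hx).deriv.symm
  have := (hasDerivWithinAt_iff_tendsto_slope' (by simp)).1 hderiv.Ioi_of_Ici
  refine this.congr fun x => ?_
  simp [slope_def_field, h.H0]

theorem hasDerivAt_slope (h : IsCOrbit α c H H' A Z ρ₁) {ρ : ℝ} (hρ : ρ ∈ Ioo 0 ρ₁) :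
    HasDerivAt (fun ρ => (H ρ + π / 2) / ρ) ((H' ρ - (H ρ + π / 2) / ρ) / ρ) ρ := by
  have hρ0 : ρ ≠ 0 := hρ.1.ne'
  refine (((h.hH ρ hρ).add_const (π / 2)).fun_div (hasDerivAt_id ρ) hρ0).congr_deriv ?_
  simp only [id]
  field_simp

theorem hasDerivAt_ratio (h : IsCOrbit α c H H' A Z ρ₁) {ρ : ℝ} (hρ : ρ ∈ Ioo 0 ρ₁) :
    HasDerivAt (fun ρ => Z ρ / ρ) (cssStretch α (H ρ + π / 2, ρ * H' ρ, Z ρ) / ρ ^ 2) ρ := by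
  have hρ0 : ρ ≠ 0 := hρ.1.ne'
  refine ((h.hZ ρ hρ).fun_div (hasDerivAt_id ρ) hρ0).congr_deriv ?_
  simp only [id, cssStretch]
  field_simp
  ring

theorem hasDerivAt_H' (hα0 : 0 < α) (hα : α < 1 / 2) (h : IsCOrbit α c H H' A Z ρ₁) {ρ : ℝ}
    (hρ : ρ ∈ Ioo 0 ρ₁) :
    HasDerivAt H' (-2 * (H' ρ - (H ρ + π / 2) / ρ) / ρ
      + cssForce α (H ρ + π / 2, ρ * H' ρ, Z ρ) / ρ ^ 2) ρ := by
  have hρ0 : ρ ≠ 0 := hρ.1.ne'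
  refine (h.hH' ρ hρ).congr_deriv ?_
  have hA := h.hApos ρ hρ
  have hZ : 0 < 1 - Z ρ ^ 2 := by nlinarith [h.hZ01 ρ hρ]
  have hcon := h.constraint ρ hρ
  have hpos := one_sub_mul_sin_sq_pos hα0 hα (H ρ + π / 2)
  have hs : sin (2 * (H ρ + π / 2)) = - sin (2 * H ρ) := by
    rw [mul_add, mul_div_cancel₀ _ (two_ne_zero), sin_add_pi]
  have key : (1 / (1 - Z ρ ^ 2) - α * (ρ * H' ρ) ^ 2) / (1 - 2 * α * sin (H ρ + π / 2) ^ 2)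
      = 1 / (A ρ * (1 - Z ρ ^ 2)) := by
    rw [div_eq_div_iff hpos.ne' (by positivity), sin_add_pi_div_two, cos_sq']
    field_simp
    linarith
  simp only [cssForce]
  rw [hs, mul_div_assoc (-sin (2 * H ρ)), key]
  field_simp
  ring

theorem ratio_monotoneOn (hα0 : 0 < α) (h : IsCOrbit α c H H' A Z ρ₁) :
    MonotoneOn (fun ρ => Z ρ / ρ) (Ioo 0 ρ₁) := by
  refine monotoneOn_of_hasDerivWithinAt_nonneg (convex_Ioo _ _)
    (fun x hx => (h.hasDerivAt_ratio hx).continuousAt.continuousWithinAt)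
    (f' := fun ρ => cssStretch α (H ρ + π / 2, ρ * H' ρ, Z ρ) / ρ ^ 2) ?_ ?_
  · intro x hx
    rw [interior_Ioo] at hx
    exact (h.hasDerivAt_ratio hx).hasDerivWithinAt
  · intro x hx
    rw [interior_Ioo] at hx
    have hZ := h.hZ01 x hx
    have : 0 ≤ 1 - Z x ^ 2 := by nlinarith
    have := hZ.1
    simp only [cssStretch]
    positivity

theorem monotoneOn_Z (hα0 : 0 < α) (h : IsCOrbit α c H H' A Z ρ₁) :
    MonotoneOn Z (Ioo 0 ρ₁) := by
  intro x hx y hy hxy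
  have h1 : Z x / x ≤ Z y / y := h.ratio_monotoneOn hα0 hx hy hxy
  have h2 : 0 ≤ Z y / y := div_nonneg (h.hZ01 y hy).1 hy.1.le
  calc Z x = Z x / x * x := by rw [div_mul_cancel₀ _ hx.1.ne']
    _ ≤ Z y / y * y := mul_le_mul h1 hxy hx.1.le h2
    _ = Z y := by rw [div_mul_cancel₀ _ hy.1.ne']

end IsCOrbit

/-- A Lyapunov function for the difference of two orbits in the variables
`k = (H + π/2)/ρ`, `w = H'`, `z = Z/ρ`. -/
def orbitEnergy (k w z : ℝ) : ℝ :=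
  (w + 2 * k) ^ 2 + (w - k) ^ 2 + z ^ 2

theorem sq_norm_le_orbitEnergy (k w z : ℝ) : ‖(k, w, z)‖ ^ 2 ≤ orbitEnergy k w z := by
  have hk : k ^ 2 ≤ orbitEnergy k w z := by
    unfold orbitEnergy; nlinarith [sq_nonneg (2 * w + k), sq_nonneg z, sq_nonneg k]
  have hw : w ^ 2 ≤ orbitEnergy k w z := by
    unfold orbitEnergy; nlinarith [sq_nonneg (5 * k + w), sq_nonneg z, sq_nonneg w]
  have hz : z ^ 2 ≤ orbitEnergy k w z := by
    unfold orbitEnergy; nlinarith [sq_nonneg (w + 2 * k), sq_nonneg (w - k)]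
  have hnn : 0 ≤ orbitEnergy k w z := (sq_nonneg _).trans hz
  have : ‖(k, w, z)‖ ≤ √(orbitEnergy k w z) := by
    simp only [norm_prod_le_iff, Real.norm_eq_abs]
    exact ⟨abs_le_sqrt hk, abs_le_sqrt hw, abs_le_sqrt hz⟩
  exact (Real.le_sqrt (norm_nonneg _) hnn).1 this

theorem orbitEnergy_deriv_le {k w z m p L ρ : ℝ} (hρ : 0 < ρ) (hL : 0 ≤ L)
    (hm : |m| ≤ L * ‖(k, w, z)‖) (hp : |p| ≤ L * ‖(k, w, z)‖) :
    2 * (w + 2 * k) * ((-2 * (w - k) / ρ + m) + 2 * ((w - k) / ρ))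
      + 2 * (w - k) * ((-2 * (w - k) / ρ + m) - (w - k) / ρ) + 2 * z * p
      ≤ 6 * L * orbitEnergy k w z := by
  set E := orbitEnergy k w z with hE
  have hnn : 0 ≤ E := (sq_nonneg _).trans (sq_norm_le_orbitEnergy k w z)
  have hN : ‖(k, w, z)‖ ≤ √E := Real.le_sqrt_of_sq_le (sq_norm_le_orbitEnergy k w z)
  have h1 : |w + 2 * k| ≤ √E := abs_le_sqrt (by
    rw [hE, orbitEnergy]; nlinarith [sq_nonneg (w - k), sq_nonneg z])
  have h2 : |w - k| ≤ √E := abs_le_sqrt (by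
    rw [hE, orbitEnergy]; nlinarith [sq_nonneg (w + 2 * k), sq_nonneg z])
  have h3 : |z| ≤ √E := abs_le_sqrt (by
    rw [hE, orbitEnergy]; nlinarith [sq_nonneg (w - k), sq_nonneg (w + 2 * k)])
  have hmul : ∀ x y : ℝ, |x| ≤ √E → |y| ≤ L * ‖(k, w, z)‖ → x * y ≤ L * E := by
    intro x y hx hy
    calc x * y ≤ |x| * |y| := by rw [← abs_mul]; exact le_abs_self _
      _ ≤ √E * (L * √E) := by
        gcongr
        exact hy.trans (by gcongr)
      _ = L * (√E * √E) := by ring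
      _ = L * E := by rw [mul_self_sqrt hnn]
  have e1 := hmul _ _ h1 hm
  have e2 := hmul _ _ h2 hm
  have e3 := hmul _ _ h3 hp
  have e4 : 0 ≤ (w - k) ^ 2 / ρ := by positivity
  have : 2 * (w + 2 * k) * ((-2 * (w - k) / ρ + m) + 2 * ((w - k) / ρ))
      + 2 * (w - k) * ((-2 * (w - k) / ρ + m) - (w - k) / ρ) + 2 * z * p
      = 2 * ((w + 2 * k) * m) + 2 * ((w - k) * m) + 2 * (z * p) - 6 * ((w - k) ^ 2 / ρ) := by
    ring
  linarith

/-- Continuous dependence on `c`, on compact subintervals of the maximal interval. -/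
theorem IsCOrbit.exists_abs_sub_le {α c₀ : ℝ} (hα0 : 0 < α) (hα : α < 1 / 2)
    {H₀ H₀' A₀ Z₀ : ℝ → ℝ} {ρ₀ : ℝ} (h₀ : IsCOrbit α c₀ H₀ H₀' A₀ Z₀ ρ₀)
    {r : ℝ} (hr : r ∈ Ioo 0 ρ₀) {κ : ℝ} (hκ : 0 < κ) (hq : Z₀ r + r * κ < 1) :
    ∃ δ > 0, ∀ (c : ℝ) (H H' A Z : ℝ → ℝ) (ρ₁ : ℝ), IsCOrbit α c H H' A Z ρ₁ → |c - c₀| < δ →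
      ∀ ρ ∈ Ioo 0 (min r ρ₁), |Z ρ - Z₀ ρ| ≤ κ * ρ := by
  have hsub : Ioc 0 r ⊆ Ioo 0 ρ₀ := fun x hx => ⟨hx.1, hx.2.trans_lt hr.2⟩
  obtain ⟨B₁, hB₁⟩ := exists_abs_le_of_tendsto_zero (b := r)
    (fun x hx => (h₀.hasDerivAt_slope (hsub hx)).continuousAt.continuousWithinAt)
    h₀.tendsto_slope
  obtain ⟨B₂, hB₂⟩ := exists_abs_le_of_tendsto_zero (b := r)
    (fun x hx => (h₀.hH' x (hsub hx)).continuousAt.continuousWithinAt)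
    h₀.H'init
  obtain ⟨B₃, hB₃⟩ := exists_abs_le_of_tendsto_zero (b := r)
    (fun x hx => (h₀.hasDerivAt_ratio (hsub hx)).continuousAt.continuousWithinAt)
    h₀.Z'init
  obtain ⟨B, hB⟩ : ∃ B, B = max B₁ (max B₂ B₃) + κ := ⟨_, rfl⟩
  have hBk : ∀ x ∈ Ioc 0 r, |(H₀ x + π / 2) / x| ≤ B - κ := fun x hx =>
    (hB₁ x hx).trans (by rw [hB, add_sub_cancel_right]; exact le_max_left _ _)
  have hBw : ∀ x ∈ Ioc 0 r, |H₀' x| ≤ B - κ := fun x hx =>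
    (hB₂ x hx).trans (by
      rw [hB, add_sub_cancel_right]; exact (le_max_left _ _).trans (le_max_right _ _))
  have hBz : ∀ x ∈ Ioc 0 r, |Z₀ x / x| ≤ B - κ := fun x hx =>
    (hB₃ x hx).trans (by
      rw [hB, add_sub_cancel_right]; exact (le_max_right _ _).trans (le_max_right _ _))
  have hB0 : 0 ≤ B := by
    have := (abs_nonneg _).trans (hBw r ⟨hr.1, le_rfl⟩)
    linarith
  have hq0 : 0 ≤ Z₀ r + r * κ := add_nonneg (h₀.hZ01 r hr).1 (mul_nonneg hr.1.le hκ.le)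
  obtain ⟨C, hC, hlip⟩ := exists_css_lipschitz hα0 hα (mul_nonneg hr.1.le hB0) hq0 hq
  set L := C * B with hL
  have hL0 : 0 ≤ L := mul_nonneg hC hB0
  set G := exp ((6 * L + 1) * r) with hG
  have hG1 : 1 ≤ G := one_le_exp (by have := hr.1; positivity)
  refine ⟨κ / (4 * G), by positivity, ?_⟩
  intro c H H' A Z ρ₁ h hc
  set E : ℝ → ℝ := fun ρ => orbitEnergy ((H ρ + π / 2) / ρ - (H₀ ρ + π / 2) / ρ)
    (H' ρ - H₀' ρ) (Z ρ / ρ - Z₀ ρ / ρ) with hE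
  have hsub₀ : Ioo 0 (min r ρ₁) ⊆ Ioo 0 ρ₀ := fun x hx =>
    ⟨hx.1, hx.2.trans ((min_le_left _ _).trans_lt hr.2)⟩
  have hsub₁ : Ioo 0 (min r ρ₁) ⊆ Ioo 0 ρ₁ := fun x hx =>
    ⟨hx.1, hx.2.trans_le (min_le_right _ _)⟩
  have hsubr : Ioo 0 (min r ρ₁) ⊆ Ioc 0 r := fun x hx =>
    ⟨hx.1, hx.2.le.trans (min_le_left _ _)⟩
  have hbdd : ∀ ρ ∈ Ioo 0 (min r ρ₁), E ρ < κ ^ 2 →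
      ‖((H ρ + π / 2) / ρ - (H₀ ρ + π / 2) / ρ, H' ρ - H₀' ρ, Z ρ / ρ - Z₀ ρ / ρ)‖ ≤ κ := by
    intro ρ _ hlt
    exact abs_le_of_sq_le_sq' ((sq_norm_le_orbitEnergy _ _ _).trans hlt.le) hκ.le |>.2
  have hlim : Tendsto E (𝓝[>] 0) (𝓝 (9 * (c - c₀) ^ 2)) := by
    have hk := h.tendsto_slope.sub h₀.tendsto_slope
    have hw := h.H'init.sub h₀.H'init
    have hz := h.Z'init.sub h₀.Z'init
    have := (((hw.add (hk.const_mul 2)).pow 2).add ((hw.sub hk).pow 2)).add (hz.pow 2)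
    have hval : (c - c₀ + 2 * (c - c₀)) ^ 2 + (c - c₀ - (c - c₀)) ^ 2 + ((1 : ℝ) - 1) ^ 2
        = 9 * (c - c₀) ^ 2 := by ring
    rw [hval] at this
    exact this
  have key := lt_of_deriv_le_of_tendsto_zero (E := E) (m := min r ρ₁) (C := 6 * L)
    (E₀ := 9 * (c - c₀) ^ 2) (η := κ ^ 2) (by positivity) (by positivity)
    (E' := fun ρ =>
      2 * ((H' ρ - H₀' ρ) + 2 * ((H ρ + π / 2) / ρ - (H₀ ρ + π / 2) / ρ))
        * ((-2 * ((H' ρ - H₀' ρ) - ((H ρ + π / 2) / ρ - (H₀ ρ + π / 2) / ρ)) / ρ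
          + (cssForce α (H ρ + π / 2, ρ * H' ρ, Z ρ)
            - cssForce α (H₀ ρ + π / 2, ρ * H₀' ρ, Z₀ ρ)) / ρ ^ 2)
          + 2 * (((H' ρ - H₀' ρ) - ((H ρ + π / 2) / ρ - (H₀ ρ + π / 2) / ρ)) / ρ))
      + 2 * ((H' ρ - H₀' ρ) - ((H ρ + π / 2) / ρ - (H₀ ρ + π / 2) / ρ))
        * ((-2 * ((H' ρ - H₀' ρ) - ((H ρ + π / 2) / ρ - (H₀ ρ + π / 2) / ρ)) / ρ
          + (cssForce α (H ρ + π / 2, ρ * H' ρ, Z ρ)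
            - cssForce α (H₀ ρ + π / 2, ρ * H₀' ρ, Z₀ ρ)) / ρ ^ 2)
          - ((H' ρ - H₀' ρ) - ((H ρ + π / 2) / ρ - (H₀ ρ + π / 2) / ρ)) / ρ)
      + 2 * (Z ρ / ρ - Z₀ ρ / ρ)
        * ((cssStretch α (H ρ + π / 2, ρ * H' ρ, Z ρ)
            - cssStretch α (H₀ ρ + π / 2, ρ * H₀' ρ, Z₀ ρ)) / ρ ^ 2))
    ?_ hlim ?_ ?_
  · intro ρ hρ
    have hlt := key ρ hρ
    have hz := (norm_snd_le _).trans ((norm_snd_le _).trans (hbdd ρ hρ hlt))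
    simp only [Real.norm_eq_abs] at hz
    rwa [← sub_div, abs_div, abs_of_pos hρ.1, div_le_iff₀ hρ.1] at hz
  · intro ρ hρ
    have hk := (h.hasDerivAt_slope (hsub₁ hρ)).fun_sub (h₀.hasDerivAt_slope (hsub₀ hρ))
    have hw := (h.hasDerivAt_H' hα0 hα (hsub₁ hρ)).fun_sub (h₀.hasDerivAt_H' hα0 hα (hsub₀ hρ))
    have hz := (h.hasDerivAt_ratio (hsub₁ hρ)).fun_sub (h₀.hasDerivAt_ratio (hsub₀ hρ))
    have := (((hw.fun_add (hk.const_mul 2)).fun_pow 2).fun_add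
      ((hw.fun_sub hk).fun_pow 2)).fun_add (hz.fun_pow 2)
    refine this.congr_deriv ?_
    ring
  · intro ρ hρ hlt
    have hρ0 : 0 < ρ := hρ.1
    have hρr := hsubr hρ
    have hdist := hbdd ρ hρ hlt
    set V : ℝ × ℝ × ℝ := ((H ρ + π / 2) / ρ, H' ρ, Z ρ / ρ) with hV
    set V₀ : ℝ × ℝ × ℝ := ((H₀ ρ + π / 2) / ρ, H₀' ρ, Z₀ ρ / ρ) with hV₀
    have hVV₀ : ((H ρ + π / 2) / ρ - (H₀ ρ + π / 2) / ρ, H' ρ - H₀' ρ, Z ρ / ρ - Z₀ ρ / ρ)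
        = V - V₀ := rfl
    have hX : (H ρ + π / 2, ρ * H' ρ, Z ρ) = ρ • V := by
      simp only [hV, Prod.smul_mk, smul_eq_mul, mul_div_cancel₀ _ hρ0.ne']
    have hX₀ : (H₀ ρ + π / 2, ρ * H₀' ρ, Z₀ ρ) = ρ • V₀ := by
      simp only [hV₀, Prod.smul_mk, smul_eq_mul, mul_div_cancel₀ _ hρ0.ne']
    have hV₀B : ‖V₀‖ ≤ B - κ := by
      simp only [hV₀, norm_prod_le_iff, Real.norm_eq_abs]
      exact ⟨hBk ρ hρr, hBw ρ hρr, hBz ρ hρr⟩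
    have hVB : ‖V‖ ≤ B := by
      have := norm_le_norm_add_norm_sub' V V₀
      rw [hVV₀] at hdist
      linarith
    have hnorm : ∀ W : ℝ × ℝ × ℝ, ‖W‖ ≤ B → ‖ρ • W‖ ≤ ρ * B := by
      intro W hW
      rw [norm_smul, Real.norm_eq_abs, abs_of_pos hρ0]
      gcongr
    have hZ₀le : Z₀ ρ ≤ Z₀ r := h₀.monotoneOn_Z hα0 (hsub₀ hρ) hr hρr.2
    have hZ₀nn : 0 ≤ Z₀ ρ := (h₀.hZ01 ρ (hsub₀ hρ)).1
    have hrκ : ρ * κ ≤ r * κ := mul_le_mul_of_nonneg_right hρr.2 hκ.le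
    have hρκ : 0 ≤ ρ * κ := by positivity
    have hZ₀q : |Z₀ ρ| ≤ Z₀ r + r * κ := by
      rw [abs_of_nonneg hZ₀nn]; linarith
    have hZq : |Z ρ| ≤ Z₀ r + r * κ := by
      have hz := (norm_snd_le _).trans ((norm_snd_le _).trans hdist)
      simp only [Real.norm_eq_abs] at hz
      rw [← sub_div, abs_div, abs_of_pos hρ0, div_le_iff₀ hρ0] at hz
      rw [abs_of_nonneg (h.hZ01 ρ (hsub₁ hρ)).1]
      have := (abs_le.1 hz).2
      linarith
    have hρrB : ρ * B ≤ r * B := mul_le_mul_of_nonneg_right hρr.2 hB0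
    have hX1 := (hnorm V hVB)
    have hX2 := (hnorm V₀ (hV₀B.trans (by linarith)))
    rw [← hX] at hX1
    rw [← hX₀] at hX2
    obtain ⟨hF, hS⟩ := hlip _ _ ((norm_fst_le _).trans (hX1.trans hρrB))
      ((norm_fst_le _).trans ((norm_snd_le _).trans (hX1.trans hρrB))) hZq
      ((norm_fst_le _).trans (hX2.trans hρrB))
      ((norm_fst_le _).trans ((norm_snd_le _).trans (hX2.trans hρrB))) hZ₀q (ρ * B) hX1 hX2
    have hnn : ‖(H ρ + π / 2, ρ * H' ρ, Z ρ) - (H₀ ρ + π / 2, ρ * H₀' ρ, Z₀ ρ)‖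
        = ρ * ‖V - V₀‖ := by
      rw [hX, hX₀, ← smul_sub, norm_smul, Real.norm_eq_abs, abs_of_pos hρ0]
    rw [hnn] at hF hS
    have hscale : ∀ x : ℝ, |x| ≤ C * (ρ * B) * (ρ * ‖V - V₀‖) →
        |x / ρ ^ 2| ≤ L * ‖V - V₀‖ := by
      intro x hx
      rw [abs_div, abs_of_pos (pow_pos hρ0 2), div_le_iff₀ (pow_pos hρ0 2)]
      calc |x| ≤ _ := hx
        _ = L * ‖V - V₀‖ * ρ ^ 2 := by rw [hL]; ring
    exact orbitEnergy_deriv_le hρ0 hL0 (hscale _ hF) (hscale _ hS)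
  · have hle : exp ((6 * L + 1) * min r ρ₁) ≤ G := by
      rw [hG]
      gcongr
      exact min_le_left _ _
    have hG0 : 0 < G := one_pos.trans_le hG1
    have hc2 : (c - c₀) ^ 2 ≤ (κ / (4 * G)) ^ 2 := by
      rw [← sq_abs]
      gcongr
    calc 9 * (c - c₀) ^ 2 * exp ((6 * L + 1) * min r ρ₁)
        ≤ 9 * (κ / (4 * G)) ^ 2 * G := by gcongr
      _ = 9 / 16 * κ ^ 2 / G := by field_simp; ring
      _ ≤ 9 / 16 * κ ^ 2 := div_le_self (by positivity) hG1
      _ < κ ^ 2 := by nlinarith [pow_pos hκ 2]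

/-- Corollary 3: the function `c ↦ ρ₁(c)` is continuous on `(0, ∞)`. -/
theorem corollary3 (α : ℝ) (hα0 : 0 < α) (hα : α < 1 / 2)
    (H H' A Z : ℝ → ℝ → ℝ) (ρ₁ : ℝ → ℝ)
    (horb : ∀ c, 0 < c → IsCOrbit α c (H c) (H' c) (A c) (Z c) (ρ₁ c))
    (hend : ∀ c, 0 < c → Tendsto (Z c) (𝓝[<] ρ₁ c) (𝓝 1)) :
    ∀ ct, 0 < ct → ∀ ε > 0, ∃ δ > 0, ∀ c, 0 < c → |c - ct| < δ →
      |ρ₁ c - ρ₁ ct| < ε := by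
  intro ct hct ε hε
  have h₀ := horb ct hct
  have hpos := h₀.rho1_pos
  set θ := ρ₁ ct / (ρ₁ ct + ε / 2) with hθ
  have hθ1 : θ < 1 := (div_lt_one (by positivity)).2 (by linarith)
  have hθ0 : 0 < θ := by positivity
  obtain ⟨s, hsθ, hs⟩ := (((hend ct hct).eventually_const_lt hθ1).and (Ioo_mem_nhdsLT
    (max_lt hpos (by linarith : ρ₁ ct - ε < ρ₁ ct)))).exists
  have hs0 : 0 < s := (le_max_left _ _).trans_lt hs.1
  have hsε : ρ₁ ct - ε < s := (le_max_right _ _).trans_lt hs.1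
  obtain ⟨r, hsr, hrρ⟩ := exists_between hs.2
  have hr0 : 0 < r := hs0.trans hsr
  have hr : r ∈ Ioo 0 (ρ₁ ct) := ⟨hr0, hrρ⟩
  have hZr := (h₀.hZ01 r hr).2
  obtain ⟨κ, hκ0, hκ⟩ : ∃ κ, 0 < κ ∧ r * κ < min (1 - Z ct r) (Z ct s - θ) := by
    obtain ⟨e, he0, he⟩ := exists_between
      (lt_min (sub_pos.2 hZr) (sub_pos.2 hsθ) : 0 < min (1 - Z ct r) (Z ct s - θ))
    exact ⟨e / r, by positivity, by rwa [mul_div_cancel₀ _ hr0.ne']⟩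
  obtain ⟨hκ1, hκ2⟩ := lt_min_iff.1 hκ
  have hq : Z ct r + r * κ < 1 := by linarith
  obtain ⟨δ, hδ, hclose⟩ := h₀.exists_abs_sub_le hα0 hα hr hκ0 hq
  refine ⟨δ, hδ, fun c hc hcδ => ?_⟩
  have h := horb c hc
  have hcl := hclose c _ _ _ _ _ h hcδ
  have hlow : r < ρ₁ c := by
    by_contra! hle
    rw [min_eq_right hle] at hcl
    obtain ⟨x, hx1, hx⟩ := (((hend c hc).eventually_const_lt hq).and
      (Ioo_mem_nhdsLT h.rho1_pos)).exists
    have hxr : x ≤ r := hx.2.le.trans hle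
    have h1 := (abs_le.1 (hcl x hx)).2
    have h2 := h₀.monotoneOn_Z hα0 ⟨hx.1, hxr.trans_lt hrρ⟩ hr hxr
    have h3 : x * κ ≤ r * κ := mul_le_mul_of_nonneg_right hxr hκ0.le
    linarith
  rw [min_eq_left hlow.le] at hcl
  have hZs : θ < Z c s := by
    have h1 := (abs_le.1 (hcl s ⟨hs0, hsr⟩)).1
    have h3 : s * κ ≤ r * κ := mul_le_mul_of_nonneg_right hsr.le hκ0.le
    linarith
  have hup : ρ₁ c ≤ s / θ := by
    refine le_of_forall_lt fun x hx => ?_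
    rcases le_or_gt x s with hxs | hxs
    · refine hxs.trans_lt ?_
      rw [lt_div_iff₀ hθ0]
      nlinarith
    · have hx0 : 0 < x := hs0.trans hxs
      have h1 : Z c s / s ≤ Z c x / x :=
        h.ratio_monotoneOn hα0 ⟨hs0, hxs.trans hx⟩ ⟨hx0, hx⟩ hxs.le
      have h2 := (h.hZ01 x ⟨hx0, hx⟩).2
      rw [div_le_div_iff₀ hs0 hx0] at h1
      rw [lt_div_iff₀ hθ0]
      nlinarith
  have hsθ' : s / θ < ρ₁ ct + ε := by
    rw [div_lt_iff₀ hθ0]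
    have : (ρ₁ ct + ε / 2) * θ = ρ₁ ct := mul_div_cancel₀ _ (by positivity)
    nlinarith [hs.2]
  rw [abs_lt]
  constructor <;> linarith
end
end

section
/- Let c > 0 and let (H, A, Z) be the c-orbit on (0, ρ₁(c)), with H̄ := lim_{ρ→ρ₁(c)⁻} H(ρ). Then H′ is bounded on some interval (ρ₁(c) − ε, ρ₁(c)) with ε > 0 if and only if H̄ = 0. -/
open Real Filter Set Topology Asymptotics MeasureTheory

noncomputable section

theorem antitoneOn_Ioo_of_hasDerivAt_nonpos {f f' : ℝ → ℝ} {a b : ℝ}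
    (hf : ∀ x ∈ Ioo a b, HasDerivAt f (f' x) x) (hf' : ∀ x ∈ Ioo a b, f' x ≤ 0) :
    AntitoneOn f (Ioo a b) := by
  refine antitoneOn_of_deriv_nonpos (convex_Ioo a b)
    (fun x hx => (hf x hx).continuousAt.continuousWithinAt) ?_ ?_
  · rw [interior_Ioo]
    exact fun x hx => (hf x hx).differentiableAt.differentiableWithinAt
  · rw [interior_Ioo]
    intro x hx
    rw [(hf x hx).deriv]
    exact hf' x hx

theorem AntitoneOn.eventually_le_nhdsLT {f : ℝ → ℝ} {a b x : ℝ} (hf : AntitoneOn f (Ioo a b))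
    (hx : x ∈ Ioo a b) : ∀ᶠ y in 𝓝[<] b, f y ≤ f x := by
  filter_upwards [Ioo_mem_nhdsLT hx.2] with y hy
  exact hf hx ⟨hx.1.trans hy.1, hy.2⟩ hy.1.le

theorem AntitoneOn.not_tendsto_nhdsLT_atTop {f : ℝ → ℝ} {a b : ℝ} (hab : a < b)
    (hf : AntitoneOn f (Ioo a b)) : ¬ Tendsto f (𝓝[<] b) atTop := by
  intro h
  obtain ⟨x, hx⟩ := nonempty_Ioo.2 hab
  obtain ⟨y, hy, hy'⟩ :=
    ((hf.eventually_le_nhdsLT hx).and (h.eventually_gt_atTop (f x))).exists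
  exact absurd hy hy'.not_ge

theorem AntitoneOn.le_of_tendsto_nhdsLT {f : ℝ → ℝ} {a b l x : ℝ}
    (hf : AntitoneOn f (Ioo a b)) (h : Tendsto f (𝓝[<] b) (𝓝 l)) (hx : x ∈ Ioo a b) :
    l ≤ f x :=
  le_of_tendsto h (hf.eventually_le_nhdsLT hx)

theorem AntitoneOn.le_of_tendsto_nhdsGT {f : ℝ → ℝ} {a b l x : ℝ}
    (hf : AntitoneOn f (Ioo a b)) (h : Tendsto f (𝓝[>] a) (𝓝 l)) (hx : x ∈ Ioo a b) :
    f x ≤ l := by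
  refine ge_of_tendsto h ?_
  filter_upwards [Ioo_mem_nhdsGT hx.1] with y hy
  exact hf ⟨hy.1, hy.2.trans hx.2⟩ hx hy.2.le

theorem eventually_nhdsLT_iff_exists_Ioo {p : ℝ → Prop} {b : ℝ} (hb : 0 < b) :
    (∀ᶠ x in 𝓝[<] b, p x) ↔ ∃ a, 0 < a ∧ a < b ∧ ∀ x ∈ Ioo a b, p x := by
  constructor
  · intro h
    obtain ⟨a, ha, hab⟩ := (mem_nhdsLT_iff_exists_mem_Ico_Ioo_subset hb).1 h
    exact ⟨(a + b) / 2, by linarith [ha.1], by linarith [ha.2],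
      fun x hx => hab ⟨by linarith [ha.2, hx.1], hx.2⟩⟩
  · rintro ⟨a, -, hab, h⟩
    exact mem_of_superset (Ioo_mem_nhdsLT hab) h

namespace IsCOrbit

variable {α c ρ₁ Hbar : ℝ} {H H' A Z : ℝ → ℝ}

theorem antitoneOn_A (h : IsCOrbit α c H H' A Z ρ₁) (hα : 0 < α) :
    AntitoneOn A (Ioo 0 ρ₁) := by
  refine antitoneOn_Ioo_of_hasDerivAt_nonpos h.hA fun x hx => ?_
  have h1 := mul_nonneg (mul_nonneg (mul_nonneg hα.le hx.1.le) (h.hApos x hx).le)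
    (sq_nonneg (H' x))
  linarith

theorem A_lt_one (h : IsCOrbit α c H H' A Z ρ₁) (hα : 0 < α) (hc : 0 < c) {x : ℝ}
    (hx : x ∈ Ioo 0 ρ₁) : A x < 1 := by
  have hle : ∀ y ∈ Ioo 0 ρ₁, A y ≤ 1 := fun y hy =>
    (h.antitoneOn_A hα).le_of_tendsto_nhdsGT h.Acont hy
  by_contra! hge
  obtain ⟨y, hy, hpos⟩ :=
    (Filter.Eventually.and (Ioo_mem_nhdsGT hx.1)
      (h.H'init.eventually (lt_mem_nhds hc))).exists
  have hy' : y ∈ Ioo 0 ρ₁ := ⟨hy.1, hy.2.trans hx.2⟩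
  have hy1 : 1 ≤ A y := hge.trans (h.antitoneOn_A hα hy' hx hy.2.le)
  have hmax : IsLocalMax A y := by
    filter_upwards [Ioo_mem_nhds hy'.1 hy'.2] with z hz
    exact (hle z hz).trans hy1
  have h0 := hmax.hasDerivAt_eq_zero (h.hA y hy')
  have h1 := mul_pos (mul_pos (mul_pos hα hy.1) (h.hApos y hy')) (pow_pos hpos 2)
  linarith

theorem one_sub_A_le (h : IsCOrbit α c H H' A Z ρ₁) (hα : 0 < α) {x : ℝ}
    (hx : x ∈ Ioo 0 ρ₁) : 1 - A x ≤ 2 * α * cos (H x) ^ 2 := by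
  have h1 := h.constraint x hx
  have hZ := h.hZ01 x hx
  have h2 : 0 ≤ α * A x * x ^ 2 * H' x ^ 2 * (1 - Z x ^ 2) := by
    have := (h.hApos x hx).le
    have : 0 ≤ 1 - Z x ^ 2 := by nlinarith
    positivity
  have h3 := sin_sq_add_cos_sq (H x)
  have h4 : sin (H x) ^ 2 = 1 - cos (H x) ^ 2 := by linarith
  rw [h4] at h1
  linarith

theorem cos_H_ne_zero (h : IsCOrbit α c H H' A Z ρ₁) (hα : 0 < α) (hc : 0 < c) {x : ℝ}
    (hx : x ∈ Ioo 0 ρ₁) : cos (H x) ≠ 0 := by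
  intro h0
  have h1 := h.one_sub_A_le hα hx
  rw [h0] at h1
  linarith [h.A_lt_one hα hc hx]

theorem exists_H_mem (h : IsCOrbit α c H H' A Z ρ₁) (hα : 0 < α) (hc : 0 < c) :
    ∃ x ∈ Ioo 0 ρ₁, H x ∈ Ioo (-(π / 2)) (π / 2) := by
  obtain ⟨b, hb, hb'⟩ := (mem_nhdsGT_iff_exists_mem_Ioc_Ioo_subset h.rho1_pos).1
    ((h.H'init.eventually (lt_mem_nhds hc)).and
      (h.Hcont.eventually (gt_mem_nhds (show -(π / 2) < π / 2 by linarith [pi_pos]))))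
  have hmem : b / 2 ∈ Ioo 0 b := ⟨by linarith [hb.1], by linarith [hb.1]⟩
  have hsub : Ioo 0 b ⊆ Ioo 0 ρ₁ := Ioo_subset_Ioo_right hb.2
  have hanti : AntitoneOn (fun x => -H x) (Ioo 0 b) :=
    antitoneOn_Ioo_of_hasDerivAt_nonpos (fun x hx => (h.hH x (hsub hx)).neg)
      fun x hx => by linarith [(hb' hx).1]
  have hge := hanti.le_of_tendsto_nhdsGT h.Hcont.neg hmem
  refine ⟨b / 2, hsub hmem, lt_of_le_of_ne (by linarith) fun heq => ?_, (hb' hmem).2⟩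
  apply h.cos_H_ne_zero hα hc (hsub hmem)
  rw [← heq, cos_neg, cos_pi_div_two]

theorem H_mem (h : IsCOrbit α c H H' A Z ρ₁) (hα : 0 < α) (hc : 0 < c) {y : ℝ}
    (hy : y ∈ Ioo 0 ρ₁) : H y ∈ Ioo (-(π / 2)) (π / 2) := by
  obtain ⟨x, hx, hHx⟩ := h.exists_H_mem hα hc
  have hconn : (H '' Ioo 0 ρ₁).OrdConnected :=
    (isPreconnected_Ioo.image H fun z hz =>
      (h.hH z hz).continuousAt.continuousWithinAt).ordConnected
  have hne : ∀ t ∈ H '' Ioo 0 ρ₁, cos t ≠ 0 := by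
    rintro _ ⟨z, hz, rfl⟩
    exact h.cos_H_ne_zero hα hc hz
  constructor
  · by_contra! hle
    exact hne _ (hconn.out (mem_image_of_mem H hy) (mem_image_of_mem H hx) ⟨hle, hHx.1.le⟩)
      (by rw [cos_neg, cos_pi_div_two])
  · by_contra! hle
    exact hne _ (hconn.out (mem_image_of_mem H hx) (mem_image_of_mem H hy) ⟨hHx.2.le, hle⟩)
      cos_pi_div_two

theorem limit_H_mem (h : IsCOrbit α c H H' A Z ρ₁) (hα : 0 < α) (hc : 0 < c)
    (hH : Tendsto H (𝓝[<] ρ₁) (𝓝 Hbar)) : Hbar ∈ Ioo (-(π / 2)) (π / 2) := by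
  have hev : ∀ᶠ x in 𝓝[<] ρ₁, x ∈ Ioo 0 ρ₁ := Ioo_mem_nhdsLT h.rho1_pos
  have hge : -(π / 2) ≤ Hbar := ge_of_tendsto hH (hev.mono fun x hx => (h.H_mem hα hc hx).1.le)
  have hle : Hbar ≤ π / 2 := le_of_tendsto hH (hev.mono fun x hx => (h.H_mem hα hc hx).2.le)
  have hmid : ρ₁ / 2 ∈ Ioo 0 ρ₁ := ⟨by linarith [h.rho1_pos], by linarith [h.rho1_pos]⟩
  have hcos : 1 - A (ρ₁ / 2) ≤ 2 * α * cos Hbar ^ 2 := by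
    refine ge_of_tendsto ((((continuous_cos.tendsto Hbar).comp hH).pow 2).const_mul (2 * α)) ?_
    filter_upwards [Ioo_mem_nhdsLT hmid.2] with x hx
    have hx' : x ∈ Ioo 0 ρ₁ := ⟨hmid.1.trans hx.1, hx.2⟩
    exact le_trans (by linarith [h.antitoneOn_A hα hmid hx' hx.1.le]) (h.one_sub_A_le hα hx')
  have hpos := h.A_lt_one hα hc hmid
  refine ⟨lt_of_le_of_ne hge ?_, lt_of_le_of_ne hle ?_⟩
  · rintro rfl
    rw [cos_neg, cos_pi_div_two] at hcos
    linarith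
  · rintro rfl
    rw [cos_pi_div_two] at hcos
    linarith

theorem one_sub_sq_pos (h : IsCOrbit α c H H' A Z ρ₁) {x : ℝ} (hx : x ∈ Ioo 0 ρ₁) :
    0 < 1 - Z x ^ 2 := by
  have hZ := h.hZ01 x hx
  nlinarith

theorem hasDerivAt_one_sub_sq (h : IsCOrbit α c H H' A Z ρ₁) {x : ℝ} (hx : x ∈ Ioo 0 ρ₁) :
    HasDerivAt (fun x => 1 - Z x ^ 2)
      (-(2 * Z x ^ 2 * (1 + α * (1 - Z x ^ 2) * (x * H' x) ^ 2)) / x) x := by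
  have hx0 := hx.1.ne'
  refine (((h.hZ x hx).pow 2).const_sub 1).congr_deriv ?_
  field_simp
  norm_num
  ring

theorem hasDerivAt_mul_H' (h : IsCOrbit α c H H' A Z ρ₁) {x : ℝ} (hx : x ∈ Ioo 0 ρ₁) :
    HasDerivAt (fun x => x * H' x)
      ((-(x * H' x) + α * (1 + Z x ^ 2) * (x * H' x) ^ 3
        - sin (2 * H x) / (A x * (1 - Z x ^ 2))) / x) x := by
  have hx0 := hx.1.ne'
  have hs := (h.one_sub_sq_pos hx).ne'
  have hA := (h.hApos x hx).ne'
  refine ((hasDerivAt_id x).mul (h.hH' x hx)).congr_deriv ?_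
  rw [id]
  field_simp
  ring

theorem tendsto_one_sub_sq (hZ : Tendsto Z (𝓝[<] ρ₁) (𝓝 1)) :
    Tendsto (fun x => 1 - Z x ^ 2) (𝓝[<] ρ₁) (𝓝 0) := by
  simpa using (hZ.pow 2).const_sub 1

theorem tendsto_log_one_sub_sq (h : IsCOrbit α c H H' A Z ρ₁)
    (hZ : Tendsto Z (𝓝[<] ρ₁) (𝓝 1)) :
    Tendsto (fun x => log (1 - Z x ^ 2)) (𝓝[<] ρ₁) atBot := by
  refine tendsto_log_nhdsGT_zero.comp (tendsto_nhdsWithin_iff.2 ⟨tendsto_one_sub_sq hZ, ?_⟩)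
  filter_upwards [Ioo_mem_nhdsLT h.rho1_pos] with x hx
  exact h.one_sub_sq_pos hx

theorem not_bounded_H' (h : IsCOrbit α c H H' A Z ρ₁) (hα : 0 < α) (hc : 0 < c)
    (hZ : Tendsto Z (𝓝[<] ρ₁) (𝓝 1)) (hH : Tendsto H (𝓝[<] ρ₁) (𝓝 Hbar))
    (hne : sin (2 * Hbar) ≠ 0) (M : ℝ) : ¬ ∀ᶠ x in 𝓝[<] ρ₁, |H' x| ≤ M := by
  intro hM
  obtain ⟨σ, hσ, hpos⟩ : ∃ σ : ℝ, |σ| = 1 ∧ 0 < σ * sin (2 * Hbar) := by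
    rcases lt_or_gt_of_ne hne with hlt | hgt
    · exact ⟨-1, by simp, by linarith⟩
    · exact ⟨1, by simp, by linarith⟩
  obtain ⟨δ, hδ, hδ'⟩ := exists_between hpos
  have hsin : Tendsto (fun x => σ * sin (2 * H x)) (𝓝[<] ρ₁) (𝓝 (σ * sin (2 * Hbar))) :=
    ((continuous_sin.tendsto _).comp (hH.const_mul 2)).const_mul σ
  obtain ⟨a, ha, hab, hev⟩ := (eventually_nhdsLT_iff_exists_Ioo h.rho1_pos).1
    (hM.and (hsin.eventually (lt_mem_nhds hδ')))
  have hsub : Ioo a ρ₁ ⊆ Ioo 0 ρ₁ := Ioo_subset_Ioo_left ha.le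
  have hM0 : 0 ≤ M := by
    obtain ⟨x, hx⟩ := nonempty_Ioo.2 hab
    exact (abs_nonneg _).trans (hev x hx).1
  set N := ρ₁ * M
  have hN0 : 0 ≤ N := mul_nonneg h.rho1_pos.le hM0
  have hv : ∀ x ∈ Ioo a ρ₁, |x * H' x| ≤ N := fun x hx => by
    rw [abs_mul, abs_of_pos (hsub hx).1]
    exact mul_le_mul hx.2.le (hev x hx).1 (abs_nonneg _) h.rho1_pos.le
  set K₁ := N + 2 * α * N ^ 3 with hK₁
  set K₂ := 2 * (1 + α * N ^ 2) with hK₂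
  have hK₁0 : 0 ≤ K₁ := by positivity
  have hK₂0 : 0 < K₂ := by positivity
  have hanti := antitoneOn_Ioo_of_hasDerivAt_nonpos (a := a) (b := ρ₁) (fun x hx =>
    (((h.hasDerivAt_mul_H' (hsub hx)).const_mul σ).sub
      (((h.hasDerivAt_one_sub_sq (hsub hx)).log (h.one_sub_sq_pos (hsub hx)).ne').const_mul
        (δ / K₂))).sub ((hasDerivAt_log (hsub hx).1.ne').const_mul K₁)) (fun x hx => ?_)
  · refine hanti.not_tendsto_nhdsLT_atTop hab ?_
    have hlog := (h.tendsto_log_one_sub_sq hZ).const_mul_atBot_of_neg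
      (r := -(δ / K₂)) (by simp only [neg_lt_zero]; positivity)
    refine tendsto_atTop_mono' _ ?_ (tendsto_atTop_add_const_right _ (-N - K₁ * log ρ₁) hlog)
    filter_upwards [Ioo_mem_nhdsLT hab] with x hx
    have h1 : -N ≤ σ * (x * H' x) := by
      refine (abs_le.1 ?_).1
      rw [abs_mul, hσ, one_mul]
      exact hv x hx
    have h2 := mul_le_mul_of_nonneg_left (log_le_log (hsub hx).1 hx.2.le) hK₁0
    simp only [Pi.sub_apply]
    linarith
  · have hx0 := (hsub hx).1
    have hs := h.one_sub_sq_pos (hsub hx)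
    have hApos := h.hApos x (hsub hx)
    have hA1 := (h.A_lt_one hα hc (hsub hx)).le
    have hZ1 := h.hZ01 x (hsub hx)
    have hvx := hv x hx
    have hsx := (hev x hx).2
    set v := x * H' x
    set s := 1 - Z x ^ 2 with hs_def
    have hZ2 : 0 ≤ Z x ^ 2 := sq_nonneg _
    have hv2 : v ^ 2 ≤ N ^ 2 := sq_le_sq' (abs_le.1 hvx).1 (abs_le.1 hvx).2
    have hv3 : |v ^ 3| ≤ N ^ 3 := by
      rw [abs_pow]
      exact pow_le_pow_left₀ (abs_nonneg v) hvx 3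
    have e1 : σ * (-v + α * (1 + Z x ^ 2) * v ^ 3) ≤ K₁ := by
      refine (le_abs_self _).trans ?_
      rw [abs_mul, hσ, one_mul]
      refine (abs_add_le _ _).trans ?_
      rw [abs_neg, abs_mul (α * (1 + Z x ^ 2)), abs_of_nonneg (by positivity : 0 ≤ α * (1 + Z x ^ 2))]
      have : α * (1 + Z x ^ 2) ≤ 2 * α := by nlinarith
      have := mul_le_mul this hv3 (abs_nonneg _) (by positivity)
      linarith
    have e2 : δ / s ≤ σ * sin (2 * H x) / (A x * s) := by
      rw [div_le_div_iff₀ hs (by positivity)]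
      have h1 : A x * s ≤ s := by nlinarith
      nlinarith [mul_le_mul_of_nonneg_left h1 hδ.le, mul_le_mul_of_nonneg_right hsx.le hs.le]
    have e3 : 2 * Z x ^ 2 * (1 + α * s * v ^ 2) ≤ K₂ := by
      have h1 : s * v ^ 2 ≤ N ^ 2 := by nlinarith [sq_nonneg v]
      have h2 : α * s * v ^ 2 ≤ α * N ^ 2 := by nlinarith
      have h3 : 0 ≤ 1 + α * s * v ^ 2 := by positivity
      nlinarith
    have e4 : δ / K₂ * (2 * Z x ^ 2 * (1 + α * s * v ^ 2) / s) ≤ δ / s := by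
      rw [div_mul_div_comm, div_le_div_iff₀ (by positivity) hs]
      nlinarith [mul_le_mul_of_nonneg_left e3 (mul_pos hδ hs).le]
    have e5 : (σ * (-v + α * (1 + Z x ^ 2) * v ^ 3) - σ * sin (2 * H x) / (A x * s)
        + δ / K₂ * (2 * Z x ^ 2 * (1 + α * s * v ^ 2) / s) - K₁) / x ≤ 0 :=
      div_nonpos_of_nonpos_of_nonneg (by linarith) hx0.le
    refine le_of_eq_of_le ?_ e5
    field_simp
    ring

theorem energy_eq (h : IsCOrbit α c H H' A Z ρ₁) {x : ℝ} (hx : x ∈ Ioo 0 ρ₁) :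
    α * A x * (1 - Z x ^ 2) * (x * H' x) ^ 2
      = A x - (1 - 2 * α) - 2 * α * sin (H x) ^ 2 := by
  linarith [h.constraint x hx]

theorem lower_bound_A (h : IsCOrbit α c H H' A Z ρ₁) (hα : 0 < α) {x : ℝ}
    (hx : x ∈ Ioo 0 ρ₁) : 1 - 2 * α ≤ A x := by
  nlinarith [h.one_sub_A_le hα hx, cos_sq_le_one (H x)]

theorem tendsto_A (h : IsCOrbit α c H H' A Z ρ₁) (hα : 0 < α) (hα' : α < 1 / 2) (hc : 0 < c)
    (hZ : Tendsto Z (𝓝[<] ρ₁) (𝓝 1)) (hH : Tendsto H (𝓝[<] ρ₁) (𝓝 0)) :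
    Tendsto A (𝓝[<] ρ₁) (𝓝 (1 - 2 * α)) := by
  suffices hsmall : ∀ ε > 0, ∃ x ∈ Ioo 0 ρ₁, A x < 1 - 2 * α + ε by
    refine tendsto_order.2 ⟨fun l hl => ?_, fun u hu => ?_⟩
    · filter_upwards [Ioo_mem_nhdsLT h.rho1_pos] with x hx
      exact hl.trans_le (h.lower_bound_A hα hx)
    · obtain ⟨x, hx, hAx⟩ := hsmall (u - (1 - 2 * α)) (by linarith)
      filter_upwards [(h.antitoneOn_A hα).eventually_le_nhdsLT hx] with y hy
      linarith
  by_contra! hbig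
  obtain ⟨ε, hε, hbig⟩ := hbig
  have hsin : Tendsto (fun x => 2 * α * sin (H x) ^ 2) (𝓝[<] ρ₁) (𝓝 0) := by
    simpa using (((continuous_sin.tendsto _).comp hH).pow 2).const_mul (2 * α)
  obtain ⟨a, ha, hab, hev⟩ := (eventually_nhdsLT_iff_exists_Ioo h.rho1_pos).1
    (hsin.eventually (gt_mem_nhds (half_pos hε)))
  have hsub : Ioo a ρ₁ ⊆ Ioo 0 ρ₁ := Ioo_subset_Ioo_left ha.le
  have hm : 0 < 1 - 2 * α := by linarith
  set K := 2 * (1 + 1 / (1 - 2 * α)) with hK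
  have hK0 : 0 < K := by positivity
  have hanti := antitoneOn_Ioo_of_hasDerivAt_nonpos (a := a) (b := ρ₁) (fun x hx =>
    ((h.hA x (hsub hx)).log (h.hApos x (hsub hx)).ne').sub
      (((h.hasDerivAt_one_sub_sq (hsub hx)).log (h.one_sub_sq_pos (hsub hx)).ne').const_mul
        (ε / K))) (fun x hx => ?_)
  · refine hanti.not_tendsto_nhdsLT_atTop hab ?_
    have hlog := (h.tendsto_log_one_sub_sq hZ).const_mul_atBot_of_neg
      (r := -(ε / K)) (by simp only [neg_lt_zero]; positivity)
    refine tendsto_atTop_mono' _ ?_ (tendsto_atTop_add_const_right _ (log (1 - 2 * α)) hlog)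
    filter_upwards [Ioo_mem_nhdsLT hab] with x hx
    have h1 := log_le_log hm (h.lower_bound_A hα (hsub hx))
    simp only [Pi.sub_apply]
    linarith
  · have hx0 := (hsub hx).1
    have hs := h.one_sub_sq_pos (hsub hx)
    have hApos := h.hApos x (hsub hx)
    have hA1 := (h.A_lt_one hα hc (hsub hx)).le
    have hA2 := h.lower_bound_A hα (hsub hx)
    have hE := h.energy_eq (hsub hx)
    have hsx := hev x hx
    have hbx := hbig x (hsub hx)
    have hvdef : H' x = x * H' x / x := by field_simp
    have hsn := sq_nonneg (sin (H x))
    rw [hvdef]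
    set v := x * H' x
    have hZ2 : 0 ≤ Z x ^ 2 := sq_nonneg _
    set s := 1 - Z x ^ 2 with hs_def
    have hw : 0 ≤ α * s * v ^ 2 := by positivity
    have e1 : ε / 2 ≤ α * s * v ^ 2 := by nlinarith
    have e2 : α * s * v ^ 2 ≤ 1 / (1 - 2 * α) := by
      rw [le_div_iff₀ hm]
      nlinarith
    have e3 : 2 * Z x ^ 2 * (1 + α * s * v ^ 2) ≤ K := by nlinarith
    have e4 : ε / K * (2 * Z x ^ 2 * (1 + α * s * v ^ 2) / s) ≤ ε / s := by
      rw [div_mul_div_comm, div_le_div_iff₀ (by positivity) hs]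
      nlinarith [mul_le_mul_of_nonneg_left e3 (mul_pos hε hs).le]
    have e5 : ε / s ≤ 2 * α * v ^ 2 := by
      rw [div_le_iff₀ hs]
      linarith
    have e6 : (-(2 * α * v ^ 2) + ε / K * (2 * Z x ^ 2 * (1 + α * s * v ^ 2) / s)) / x ≤ 0 :=
      div_nonpos_of_nonpos_of_nonneg (by linarith) hx0.le
    refine le_of_eq_of_le ?_ e6
    field_simp
    ring

theorem H_sq_le (h : IsCOrbit α c H H' A Z ρ₁) (hα : 0 < α) (hα' : α < 1 / 2) (hc : 0 < c)
    (hZ : Tendsto Z (𝓝[<] ρ₁) (𝓝 1)) (hH : Tendsto H (𝓝[<] ρ₁) (𝓝 0)) :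
    ∀ᶠ x in 𝓝[<] ρ₁, H x ^ 2
      ≤ 4 * ((A x - (1 - 2 * α)) / (2 * α * (1 - 2 * α))) * (1 - Z x ^ 2) := by
  have hm : 0 < 1 - 2 * α := by linarith
  set k := 2 * α * (1 - 2 * α) with hk
  have hk0 : 0 < k := by positivity
  obtain ⟨a, ha, hab, hev⟩ := (eventually_nhdsLT_iff_exists_Ioo h.rho1_pos).1
    ((tendsto_one_sub_sq hZ).eventually (gt_mem_nhds (half_pos one_pos)))
  have hsub : Ioo a ρ₁ ⊆ Ioo 0 ρ₁ := Ioo_subset_Ioo_left ha.le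
  have hbound : ∀ σ : ℝ, |σ| = 1 → ∀ l > 0, ∀ x ∈ Ioo a ρ₁,
      0 ≤ σ * H x + l / k * (A x - (1 - 2 * α)) + 1 / l * (1 - Z x ^ 2) := by
    intro σ hσ l hl x hx
    have hanti := antitoneOn_Ioo_of_hasDerivAt_nonpos (a := a) (b := ρ₁) (fun x hx =>
      (((h.hH x (hsub hx)).const_mul σ).add
        (((h.hA x (hsub hx)).sub_const (1 - 2 * α)).const_mul (l / k))).add
        ((h.hasDerivAt_one_sub_sq (hsub hx)).const_mul (1 / l))) (fun x hx => ?_)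
    · refine hanti.le_of_tendsto_nhdsLT ?_ hx
      have := ((hH.const_mul σ).add
        (((h.tendsto_A hα hα' hc hZ hH).sub_const (1 - 2 * α)).const_mul (l / k))).add
        ((tendsto_one_sub_sq hZ).const_mul (1 / l))
      simp only [mul_zero, sub_self, add_zero] at this
      exact this
    · have hx0 := (hsub hx).1
      have hs := h.one_sub_sq_pos (hsub hx)
      have hA2 := h.lower_bound_A hα (hsub hx)
      have hsx := hev x hx
      have hvdef : H' x = x * H' x / x := by field_simp
      rw [hvdef, mul_div_cancel₀ _ hx0.ne']
      set v := x * H' x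
      have e1 : 1 ≤ 2 * Z x ^ 2 * (1 + α * (1 - Z x ^ 2) * v ^ 2) := by
        have : 0 ≤ α * (1 - Z x ^ 2) * v ^ 2 := by positivity
        nlinarith
      have e2 : 1 / l ≤ 1 / l * (2 * Z x ^ 2 * (1 + α * (1 - Z x ^ 2) * v ^ 2)) :=
        le_mul_of_one_le_right (by positivity) e1
      have e3 : l * v ^ 2 ≤ l / k * (2 * α * A x * v ^ 2) := by
        rw [div_mul_eq_mul_div, le_div_iff₀ hk0]
        have : k * v ^ 2 ≤ 2 * α * A x * v ^ 2 := by
          apply mul_le_mul_of_nonneg_right _ (sq_nonneg v)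
          rw [hk]
          exact mul_le_mul_of_nonneg_left hA2 (by positivity)
        nlinarith
      have e4 : σ * v ≤ l * v ^ 2 + 1 / l := by
        have hσ2 : σ ^ 2 = 1 := by rw [← sq_abs, hσ, one_pow]
        have h1 : l * v ^ 2 + 1 / l - σ * v
            = ((2 * l * v - σ) ^ 2 + (4 - σ ^ 2)) / (4 * l) := by
          field_simp
          ring
        have h2 : 0 ≤ ((2 * l * v - σ) ^ 2 + (4 - σ ^ 2)) / (4 * l) := by
          rw [hσ2]
          positivity
        linarith
      have e5 : (σ * v - l / k * (2 * α * A x * v ^ 2)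
          - 1 / l * (2 * Z x ^ 2 * (1 + α * (1 - Z x ^ 2) * v ^ 2))) / x ≤ 0 :=
        div_nonpos_of_nonpos_of_nonneg (by linarith) hx0.le
      refine le_of_eq_of_le ?_ e5
      field_simp
      ring
  filter_upwards [Ioo_mem_nhdsLT hab] with x hx
  have hs := h.one_sub_sq_pos (hsub hx)
  have hB : 0 ≤ (A x - (1 - 2 * α)) / k :=
    div_nonneg (by linarith [h.lower_bound_A hα (hsub hx)]) hk0.le
  have hdisc := discrim_le_zero (a := (A x - (1 - 2 * α)) / k) (b := -|H x|)
    (c := 1 - Z x ^ 2) (fun l => ?_)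
  · rw [discrim, neg_sq, sq_abs] at hdisc
    linarith
  · rcases le_or_gt l 0 with hl | hl
    · nlinarith [abs_nonneg (H x), mul_nonneg hB (mul_self_nonneg l)]
    · have h1 : |H x| ≤ l / k * (A x - (1 - 2 * α)) + 1 / l * (1 - Z x ^ 2) := by
        refine abs_le.2 ⟨?_, ?_⟩
        · linarith [hbound 1 (by simp) l hl x hx]
        · linarith [hbound (-1) (by simp) l hl x hx]
      have h2 := mul_le_mul_of_nonneg_right h1 hl.le
      have h3 : (l / k * (A x - (1 - 2 * α)) + 1 / l * (1 - Z x ^ 2)) * l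
          = (A x - (1 - 2 * α)) / k * (l * l) + (1 - Z x ^ 2) := by
        field_simp
      linarith

theorem bounded_H' (h : IsCOrbit α c H H' A Z ρ₁) (hα : 0 < α) (hα' : α < 1 / 2) (hc : 0 < c)
    (hZ : Tendsto Z (𝓝[<] ρ₁) (𝓝 1)) (hH : Tendsto H (𝓝[<] ρ₁) (𝓝 0)) :
    ∃ M, ∀ᶠ x in 𝓝[<] ρ₁, |H' x| ≤ M := by
  have hm : 0 < 1 - 2 * α := by linarith
  obtain ⟨a, ha, hab, hev⟩ := (eventually_nhdsLT_iff_exists_Ioo h.rho1_pos).1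
    (h.H_sq_le hα hα' hc hZ hH)
  have hsub : Ioo a ρ₁ ⊆ Ioo 0 ρ₁ := Ioo_subset_Ioo_left ha.le
  set C := 8 / (1 - 2 * α) / a with hC
  have hC0 : 0 < C := by positivity
  have hanti := antitoneOn_Ioo_of_hasDerivAt_nonpos (a := a) (b := ρ₁) (fun x hx =>
    ((((h.hA x (hsub hx)).sub_const (1 - 2 * α)).mul (h.hA x (hsub hx))).div
      (h.hasDerivAt_one_sub_sq (hsub hx)) (h.one_sub_sq_pos (hsub hx)).ne').mul
      (((hasDerivAt_id x).const_mul (-C)).exp)) (fun x hx => ?_)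
  · obtain ⟨x₀, hx₀⟩ := nonempty_Ioo.2 hab
    have hle := hanti.eventually_le_nhdsLT hx₀
    simp only [Pi.mul_apply, Pi.div_apply, id] at hle
    set F := (A x₀ - (1 - 2 * α)) * A x₀ / (1 - Z x₀ ^ 2) * rexp (-C * x₀) with hF
    have hF0 : 0 ≤ F := by
      have h1 := h.lower_bound_A hα (hsub hx₀)
      have h2 := h.one_sub_sq_pos (hsub hx₀)
      have h3 := h.hApos x₀ (hsub hx₀)
      have h4 : 0 ≤ A x₀ - (1 - 2 * α) := by linarith
      positivity
    refine ⟨√(F * rexp (C * ρ₁) / (α * (1 - 2 * α) ^ 2 * a ^ 2)), ?_⟩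
    filter_upwards [hle, Ioo_mem_nhdsLT hab] with x hxF hx
    apply abs_le_sqrt
    have hs := h.one_sub_sq_pos (hsub hx)
    have hA2 := h.lower_bound_A hα (hsub hx)
    have hApos := h.hApos x (hsub hx)
    have hE := h.energy_eq (hsub hx)
    have hsn := sq_nonneg (sin (H x))
    set Y := (A x - (1 - 2 * α)) * A x / (1 - Z x ^ 2) with hY
    have hYle : Y ≤ F * rexp (C * ρ₁) := by
      have h1 : Y = Y * rexp (-C * x) * rexp (C * x) := by
        rw [mul_assoc, ← exp_add]
        simp
      rw [h1]
      refine mul_le_mul hxF (exp_le_exp.2 ?_) (exp_pos _).le hF0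
      exact mul_le_mul_of_nonneg_left hx.2.le hC0.le
    refine le_trans ?_ (div_le_div_of_nonneg_right hYle (by positivity))
    rw [le_div_iff₀ (by positivity), hY, le_div_iff₀ hs]
    calc H' x ^ 2 * (α * (1 - 2 * α) ^ 2 * a ^ 2) * (1 - Z x ^ 2)
        ≤ H' x ^ 2 * (α * A x ^ 2 * x ^ 2) * (1 - Z x ^ 2) := by
          have := hx.1.le
          gcongr
      _ = (α * A x * (1 - Z x ^ 2) * (x * H' x) ^ 2) * A x := by ring
      _ ≤ (A x - (1 - 2 * α)) * A x := by
          apply mul_le_mul_of_nonneg_right _ hApos.le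
          nlinarith
  · have hx0 := (hsub hx).1
    have hs := h.one_sub_sq_pos (hsub hx)
    have hApos := h.hApos x (hsub hx)
    have hA2 := h.lower_bound_A hα (hsub hx)
    have hE := h.energy_eq (hsub hx)
    have hHx := hev x hx
    have hsin : sin (H x) ^ 2 ≤ H x ^ 2 := sq_le_sq.2 abs_sin_le_abs
    have hvdef : H' x = x * H' x / x := by field_simp
    rw [hvdef, mul_div_cancel₀ _ hx0.ne']
    simp only [Pi.mul_apply, Pi.div_apply, id]
    set v := x * H' x
    have hs1 : Z x ^ 2 = 1 - (1 - Z x ^ 2) := by ring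
    rw [hs1]
    simp only [sub_sub_cancel]
    set s := 1 - Z x ^ 2 with hs_def
    set B := A x - (1 - 2 * α) with hB
    have hB0 : 0 ≤ B := by linarith
    have e1 : 4 * α * sin (H x) ^ 2 ≤ 8 / (1 - 2 * α) * (B * s) := by
      have h1 : 4 * α * (4 * (B / (2 * α * (1 - 2 * α))) * s)
          = 8 / (1 - 2 * α) * (B * s) := by
        field_simp
        ring
      rw [← h1]
      exact mul_le_mul_of_nonneg_left (hsin.trans hHx) (by positivity)
    have e2 : 8 / (1 - 2 * α) / x ≤ C := by
      rw [hC]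
      exact div_le_div_of_nonneg_left (by positivity) ha hx.1.le
    have e3 : A x / (s ^ 2 * x) * (-(2 * s * B) + 4 * α * sin (H x) ^ 2
        - 2 * α * B * s ^ 2 * v ^ 2) ≤ C * (B * A x / s) := by
      calc A x / (s ^ 2 * x) * (-(2 * s * B) + 4 * α * sin (H x) ^ 2
            - 2 * α * B * s ^ 2 * v ^ 2)
          ≤ A x / (s ^ 2 * x) * (8 / (1 - 2 * α) * (B * s)) := by
            apply mul_le_mul_of_nonneg_left _ (by positivity)
            have h1 : 0 ≤ 2 * α * B * s ^ 2 * v ^ 2 := by positivity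
            have h2 : 0 ≤ 2 * s * B := by positivity
            linarith
        _ = 8 / (1 - 2 * α) / x * (B * A x / s) := by
            field_simp
        _ ≤ C * (B * A x / s) := by gcongr
    have e4 : (A x / (s ^ 2 * x) * (-(2 * s * B) + 4 * α * sin (H x) ^ 2
        - 2 * α * B * s ^ 2 * v ^ 2) - C * (B * A x / s)) * rexp (-C * x) ≤ 0 :=
      mul_nonpos_of_nonpos_of_nonneg (by linarith) (exp_pos _).le
    refine le_of_eq_of_le ?_ e4
    have hsv : 4 * α * sin (H x) ^ 2 = 2 * B - 2 * (α * A x * s * v ^ 2) := by linarith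
    rw [hsv]
    field_simp
    ring

end IsCOrbit

/-- Lemma 4: `H'` is bounded near `ρ₁(c)` if and only if `H̄ = 0`. -/
theorem lemma4 (α : ℝ) (hα0 : 0 < α) (hα : α < 1 / 2)
    (c : ℝ) (hc : 0 < c) (H H' A Z : ℝ → ℝ) (ρ₁ : ℝ)
    (horb : IsCOrbit α c H H' A Z ρ₁)
    (hend : Tendsto Z (𝓝[<] ρ₁) (𝓝 1))
    (Hbar : ℝ) (hHbar : Tendsto H (𝓝[<] ρ₁) (𝓝 Hbar)) :
    (∃ ε > 0, ∃ M : ℝ, ∀ ρ ∈ Set.Ioo (ρ₁ - ε) ρ₁, |H' ρ| ≤ M) ↔ Hbar = 0 := by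
  constructor
  · rintro ⟨ε, hε, M, hM⟩
    by_contra hne
    have hmem := horb.limit_H_mem hα0 hc hHbar
    refine horb.not_bounded_H' hα0 hc hend hHbar ?_ M ?_
    · intro hsin
      have := (sin_eq_zero_iff_of_lt_of_lt (by linarith [hmem.1]) (by linarith [hmem.2])).1 hsin
      exact hne (by linarith)
    · filter_upwards [Ioo_mem_nhdsLT (sub_lt_self ρ₁ hε)] with x hx using hM x hx
  · rintro rfl
    obtain ⟨M, hM⟩ := horb.bounded_H' hα0 hα hc hend hHbar
    obtain ⟨a, -, hab, h⟩ := (eventually_nhdsLT_iff_exists_Ioo horb.rho1_pos).1 hM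
    exact ⟨ρ₁ - a, sub_pos.2 hab, M, by rwa [sub_sub_cancel]⟩
end
end
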